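/- arXiv:1509.02145 — 3 statements merged into one kernel-verified Lean document; each statement's English description precedes it below -/
import Mathlib

section
/- Let G be a flat, finitely presented group scheme over a scheme B, let X be a G-scheme, and let V ⊆ X be a G-invariant subscheme. Then the largest open subset of X in which V is a closed subscheme is G-invariant. If moreover V is quasi-compact, there exists a quasi-compact G-invariant open subscheme of X in which V is closed. -/
open CategoryTheory CategoryTheory.Limits AlgebraicGeometry

noncomputable section

namespace EquivariantSix

universe u

instance (B : Scheme.{u}) : HasFiniteProducts (Over B) :=
  CategoryTheory.Over.ConstructProducts.over_finiteProducts_of_finiteWidePullbacks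

/-- A morphism of schemes is flat if all of its stalk maps are flat ring homomorphisms. -/
def FlatHom {X Y : Scheme.{u}} (f : X ⟶ Y) : Prop :=
  ∀ x : X, RingHom.Flat (f.stalkMap x).hom

/-- A morphism of schemes is of finite presentation if it is locally of finite presentation,
quasi-compact and quasi-separated. -/
def FinPresHom {X Y : Scheme.{u}} (f : X ⟶ Y) : Prop :=
  LocallyOfFinitePresentation f ∧ QuasiCompact f ∧ QuasiSeparated f

/-- A scheme is quasi-compact and quasi-separated. -/
def QCQS (X : Scheme.{u}) : Prop :=
  CompactSpace X ∧ QuasiSeparatedSpace X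

/-- A group scheme over a base scheme `B`, i.e. a group object in the category of
`B`-schemes (with its cartesian monoidal structure given by fibre products over `B`). -/
structure GrpOver (B : Scheme.{u}) where
  carrier : Over B
  mul : carrier ⨯ carrier ⟶ carrier
  one : ⊤_ (Over B) ⟶ carrier
  inv : carrier ⟶ carrier
  mul_assoc : prod.map mul (𝟙 carrier) ≫ mul =
    (prod.associator carrier carrier carrier).hom ≫ prod.map (𝟙 carrier) mul ≫ mul
  one_mul : prod.lift (terminal.from carrier ≫ one) (𝟙 carrier) ≫ mul = 𝟙 carrier
  mul_one : prod.lift (𝟙 carrier) (terminal.from carrier ≫ one) ≫ mul = 𝟙 carrier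
  mul_left_inv : prod.lift inv (𝟙 carrier) ≫ mul = terminal.from carrier ≫ one

/-- The underlying scheme of a group scheme. -/
def GrpOver.sch {B : Scheme.{u}} (G : GrpOver B) : Scheme.{u} := G.carrier.left

/-- The structure morphism of a group scheme. -/
def GrpOver.π {B : Scheme.{u}} (G : GrpOver B) : G.sch ⟶ B := G.carrier.hom

/-- The group scheme `G` over `B` is flat and of finite presentation. -/
def GrpOver.FlatFinPres {B : Scheme.{u}} (G : GrpOver B) : Prop :=
  FlatHom G.π ∧ FinPresHom G.π

variable {B : Scheme.{u}} {G : GrpOver B}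

/-- A `G`-scheme: a `B`-scheme equipped with an action of the group scheme `G`. -/
structure GScheme (B : Scheme.{u}) (G : GrpOver B) where
  carrier : Over B
  act : G.carrier ⨯ carrier ⟶ carrier
  one_act : prod.lift (terminal.from carrier ≫ G.one) (𝟙 carrier) ≫ act = 𝟙 carrier
  mul_act : prod.map G.mul (𝟙 carrier) ≫ act =
    (prod.associator G.carrier G.carrier carrier).hom ≫ prod.map (𝟙 G.carrier) act ≫ act

/-- The underlying scheme of a `G`-scheme. -/
def GScheme.sch (x : GScheme B G) : Scheme.{u} := x.carrier.left

/-- The structure morphism of a `G`-scheme. -/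
def GScheme.str (x : GScheme B G) : x.sch ⟶ B := x.carrier.hom

/-- A `G`-morphism, i.e. a `G`-equivariant morphism of `G`-schemes over `B`. -/
structure GHom (x y : GScheme B G) where
  hom : x.carrier ⟶ y.carrier
  equivariant : x.act ≫ hom = prod.map (𝟙 G.carrier) hom ≫ y.act

/-- The underlying morphism of schemes of a `G`-morphism. -/
def GHom.sch {x y : GScheme B G} (f : GHom x y) : x.sch ⟶ y.sch := f.hom.left

/-- The identity `G`-morphism. -/
def GHom.id (x : GScheme B G) : GHom x x where
  hom := 𝟙 x.carrier
  equivariant := by simp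

/-- Composition of `G`-morphisms. -/
def GHom.comp {x y z : GScheme B G} (f : GHom x y) (g : GHom y z) : GHom x z where
  hom := f.hom ≫ g.hom
  equivariant := by
    rw [← Category.assoc, f.equivariant, Category.assoc, g.equivariant,
      ← Category.assoc, prod.map_map, Category.comp_id]

/-- The object of `Over B` underlying a subscheme `ι : V ⟶ X` of a `G`-scheme `x`. -/
def subOver (x : GScheme B G) {V : Scheme.{u}} (ι : V ⟶ x.sch) : Over B :=
  Over.mk (ι ≫ x.str)

/-- The morphism in `Over B` underlying a subscheme of a `G`-scheme. -/
def subHom (x : GScheme B G) {V : Scheme.{u}} (ι : V ⟶ x.sch) : subOver x ι ⟶ x.carrier :=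
  Over.homMk ι rfl

/-- A subscheme `ι : V ⟶ X` of a `G`-scheme is `G`-invariant if the action
`G ×_B X → X` restricts to a morphism `G ×_B V → V`. -/
def IsInvariantSub (x : GScheme B G) {V : Scheme.{u}} (ι : V ⟶ x.sch) : Prop :=
  ∃ r : (G.carrier ⨯ subOver x ι) ⟶ subOver x ι,
    r ≫ subHom x ι = prod.map (𝟙 G.carrier) (subHom x ι) ≫ x.act

/-- An open subscheme of a `G`-scheme is `G`-invariant if the action restricts to it. -/
def IsInvariantOpen (x : GScheme B G) (U : x.sch.Opens) : Prop :=
  IsInvariantSub x U.ι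

end EquivariantSix

namespace EquivariantSix

universe u

/-- `V` is a closed subscheme of the open `U ⊆ X`: the image of `V` lands in `U` and is
closed in `U`. -/
def ClosedInOpen {X V : Scheme.{u}} (ι : V ⟶ X) (U : X.Opens) : Prop :=
  Set.range ι.base ⊆ (U : Set X) ∧
    closure (Set.range ι.base) ∩ (U : Set X) ⊆ Set.range ι.base

section Helpers

variable {B : Scheme.{u}} {G : GrpOver B}

/-- Action on generalized points. -/
def GScheme.sm (x : GScheme B G) {T : Over B} (g : T ⟶ G.carrier) (y : T ⟶ x.carrier) :
    T ⟶ x.carrier := prod.lift g y ≫ x.act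

theorem GScheme.comp_sm (x : GScheme B G) {T S : Over B} (f : S ⟶ T) (g : T ⟶ G.carrier)
    (y : T ⟶ x.carrier) : f ≫ x.sm g y = x.sm (f ≫ g) (f ≫ y) := by
  simp [GScheme.sm, ← Category.assoc, prod.comp_lift]

theorem GScheme.sm_sm (x : GScheme B G) {T : Over B} (g h : T ⟶ G.carrier)
    (y : T ⟶ x.carrier) : x.sm g (x.sm h y) = x.sm (prod.lift g h ≫ G.mul) y := by
  have := congrArg (fun k => prod.lift (prod.lift g h) y ≫ k) x.mul_act
  simp only [← Category.assoc, prod.lift_map, Category.comp_id] at this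
  unfold GScheme.sm
  rw [this]
  congr 1
  apply Limits.prod.hom_ext <;>
    simp [prod.lift_fst, prod.lift_snd, prod.lift_fst_assoc, prod.comp_lift_assoc, prod.comp_lift]

theorem GScheme.one_sm (x : GScheme B G) {T : Over B} (y : T ⟶ x.carrier) :
    x.sm (terminal.from T ≫ G.one) y = y := by
  have := congrArg (fun k => y ≫ k) x.one_act
  simp only [← Category.assoc, prod.comp_lift, Category.comp_id] at this
  unfold GScheme.sm
  convert this using 3
  congr 1
  exact Subsingleton.elim _ _

theorem GScheme.inv_sm (x : GScheme B G) {T : Over B} (g : T ⟶ G.carrier) (y : T ⟶ x.carrier) :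
    x.sm (g ≫ G.inv) (x.sm g y) = y := by
  rw [GScheme.sm_sm]
  have := congrArg (fun k => g ≫ k) G.mul_left_inv
  simp only [← Category.assoc, prod.comp_lift, Category.comp_id] at this
  rw [this]
  convert x.one_sm y using 3
  exact Subsingleton.elim _ _

theorem GScheme.sm_inv (x : GScheme B G) {T : Over B} (g : T ⟶ G.carrier) (y : T ⟶ x.carrier) :
    x.sm g (x.sm (g ≫ G.inv) y) = y := by
  have h := x.inv_sm (g ≫ G.inv) (x.sm g (x.sm (g ≫ G.inv) y))
  rw [x.inv_sm g] at h
  rw [← h, x.inv_sm (g ≫ G.inv)]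

/-- The shear automorphism. -/
def GScheme.shear (x : GScheme B G) : (G.carrier ⨯ x.carrier) ≅ (G.carrier ⨯ x.carrier) where
  hom := prod.lift prod.fst x.act
  inv := prod.lift prod.fst (x.sm (prod.fst ≫ G.inv) prod.snd)
  hom_inv_id := by
    apply Limits.prod.hom_ext
    · simp [prod.lift_fst]
    · have h : x.act = x.sm prod.fst prod.snd := by simp [GScheme.sm]
      simp only [prod.comp_lift, prod.lift_snd, Category.id_comp, x.comp_sm, prod.lift_fst_assoc]
      rw [h, x.inv_sm]
  inv_hom_id := by
    apply Limits.prod.hom_ext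
    · simp [prod.lift_fst]
    · have := x.sm_inv (prod.fst : G.carrier ⨯ x.carrier ⟶ _) prod.snd
      simp only [prod.comp_lift, prod.lift_snd, Category.id_comp]
      exact this

theorem isPullback_prod (X Y : Over B) :
    IsPullback (prod.fst : X ⨯ Y ⟶ X).left (prod.snd : X ⨯ Y ⟶ Y).left X.hom Y.hom :=
  Over.isPullback_of_binaryFan_isLimit (BinaryFan.mk prod.fst prod.snd) (prodIsProd X Y)

theorem isPullback_map (A : Over B) {X Y : Over B} (f : X ⟶ Y) :
    IsPullback (prod.snd : A ⨯ X ⟶ X).left (prod.map (𝟙 A) f).left f.left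
      (prod.snd : A ⨯ Y ⟶ Y).left := by
  have h1 := isPullback_prod A X
  have h2 := isPullback_prod A Y
  refine IsPullback.flip (IsPullback.of_right (h₁₂ := (prod.fst : A ⨯ Y ⟶ A).left)
    (h₂₂ := Y.hom) (v₁₃ := A.hom) ?_ ?_ h2)
  · simpa [← Over.comp_left] using h1
  · simp [← Over.comp_left]

/-- Invariance of a subset. -/
def InvSet (x : GScheme B G) (S : Set x.carrier.left) : Prop :=
  ∀ p : (G.carrier ⨯ x.carrier).left,
    (prod.snd : G.carrier ⨯ x.carrier ⟶ _).left p ∈ S → x.act.left p ∈ S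

theorem left_comp_apply {X Y Z : Over B} (f : X ⟶ Y) (g : Y ⟶ Z) (p : X.left) :
    (f ≫ g).left p = g.left (f.left p) := by simp

theorem invSet_range (x : GScheme B G) {V : Scheme.{u}} (ι : V ⟶ x.sch)
    (h : IsInvariantSub x ι) : InvSet x (Set.range ι) := by
  obtain ⟨r, hr⟩ := h
  rintro p ⟨v, hv⟩
  obtain ⟨q, -, rfl⟩ := Scheme.exists_preimage_of_isPullback
    (isPullback_map G.carrier (subHom x ι)) v p hv
  rw [← left_comp_apply, ← hr, left_comp_apply]
  exact ⟨_, rfl⟩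

theorem invariantOpen_of (x : GScheme B G) (U : x.carrier.left.Opens)
    (h : InvSet x (U : Set x.carrier.left)) : IsInvariantOpen x U := by
  have hr : Set.range (prod.map (𝟙 G.carrier) (subHom x (V := U) U.ι) ≫ x.act).left ⊆
      Set.range U.ι := by
    rintro _ ⟨p, rfl⟩
    rw [left_comp_apply, Scheme.Opens.range_ι]
    apply h
    rw [← left_comp_apply, prod.map_snd, left_comp_apply]
    exact ((prod.snd : G.carrier ⨯ subOver x (V := U) U.ι ⟶ _).left p).2
  obtain ⟨l, hl⟩ : ∃ l : (G.carrier ⨯ subOver x (V := U) U.ι).left ⟶ (U : Scheme.{u}),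
      l ≫ U.ι = (prod.map (𝟙 G.carrier) (subHom x (V := U) U.ι) ≫ x.act).left :=
    ⟨IsOpenImmersion.lift U.ι _ hr, IsOpenImmersion.lift_fac U.ι _ hr⟩
  refine ⟨Over.homMk l ?_, ?_⟩
  · change l ≫ U.ι ≫ x.carrier.hom = _
    rw [← Category.assoc, hl]
    exact Over.w _
  · ext1
    exact hl

theorem InvSet.iff {x : GScheme B G} {S : Set x.carrier.left} (h : InvSet x S)
    (p : (G.carrier ⨯ x.carrier).left) :
    x.act.left p ∈ S ↔ (prod.snd : G.carrier ⨯ x.carrier ⟶ _).left p ∈ S := by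
  refine ⟨fun hp => ?_, h p⟩
  have e : (prod.snd : G.carrier ⨯ x.carrier ⟶ _) =
      prod.lift (prod.fst ≫ G.inv) x.act ≫ x.act := by
    have := x.inv_sm (prod.fst : G.carrier ⨯ x.carrier ⟶ _) prod.snd
    simpa [GScheme.sm] using this.symm
  rw [e, left_comp_apply]
  apply h
  rwa [← left_comp_apply, prod.lift_snd]

theorem universallyOpen_snd (hG : G.FlatFinPres) (X : Over B) :
    IsOpenMap (prod.snd : G.carrier ⨯ X ⟶ X).left := by
  have : Flat G.carrier.hom := Flat.of_stalkMap _ hG.1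
  have : LocallyOfFinitePresentation G.carrier.hom := hG.2.1
  have h : UniversallyOpen (prod.snd : G.carrier ⨯ X ⟶ X).left :=
    MorphismProperty.of_isPullback (isPullback_prod G.carrier X) inferInstance
  exact Scheme.Hom.isOpenMap _

theorem isOpenMap_act (hG : G.FlatFinPres) (x : GScheme B G) : IsOpenMap x.act.left := by
  have e : x.act = x.shear.hom ≫ prod.snd := by simp [GScheme.shear, prod.lift_snd]
  rw [e, Over.comp_left]
  have : IsIso x.shear.hom.left := inferInstanceAs (IsIso ((Over.forget B).map x.shear.hom))
  have h := (universallyOpen_snd hG x.carrier).comp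
    (Scheme.Hom.isOpenEmbedding x.shear.hom.left).isOpenMap
  simpa using h

theorem InvSet.closure {x : GScheme B G} (hG : G.FlatFinPres) {S : Set x.carrier.left}
    (h : InvSet x S) : InvSet x (closure S) := by
  have h1 := (isOpenMap_act hG x).preimage_closure_eq_closure_preimage
    (Scheme.Hom.continuous _) S
  have h2 := (universallyOpen_snd hG x.carrier).preimage_closure_eq_closure_preimage
    (Scheme.Hom.continuous _) S
  have h3 : x.act.left ⁻¹' S = (prod.snd : G.carrier ⨯ x.carrier ⟶ _).left ⁻¹' S :=
    Set.ext h.iff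
  intro p hp
  change p ∈ x.act.left ⁻¹' (_root_.closure S)
  rw [h1, h3, ← h2]
  exact hp

theorem invSet_orbit (x : GScheme B G) (S : Set x.carrier.left) :
    InvSet x (x.act.left '' ((prod.snd : G.carrier ⨯ x.carrier ⟶ _).left ⁻¹' S)) := by
  rintro p ⟨q, hq, hqp⟩
  obtain ⟨t, rfl, rfl⟩ := Scheme.exists_preimage_of_isPullback
    (isPullback_map G.carrier x.act) q p hqp
  have e : prod.map (𝟙 G.carrier) x.act ≫ x.act =
      (prod.lift (prod.map (𝟙 _) prod.fst ≫ G.mul) (prod.snd ≫ prod.snd)) ≫ x.act := by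
    have := x.sm_sm (T := G.carrier ⨯ (G.carrier ⨯ x.carrier)) prod.fst
      (prod.snd ≫ prod.fst) (prod.snd ≫ prod.snd)
    rw [← x.comp_sm prod.snd prod.fst prod.snd] at this
    have e1 : x.sm prod.fst prod.snd = x.act := by simp [GScheme.sm]
    rw [e1] at this
    unfold GScheme.sm at this
    convert this using 2
    · apply Limits.prod.hom_ext <;> simp [prod.lift_fst, prod.lift_snd]
    · congr 2
      apply Limits.prod.hom_ext <;> simp [prod.lift_fst, prod.lift_snd]
  refine ⟨(prod.lift (prod.map (𝟙 _) prod.fst ≫ G.mul) (prod.snd ≫ prod.snd)).left t, ?_, ?_⟩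
  · rw [Set.mem_preimage, ← left_comp_apply, prod.lift_snd, left_comp_apply]
    exact hq
  · rw [← left_comp_apply, ← left_comp_apply, e]

theorem subset_orbit (x : GScheme B G) (S : Set x.carrier.left) :
    S ⊆ x.act.left '' ((prod.snd : G.carrier ⨯ x.carrier ⟶ _).left ⁻¹' S) := by
  intro s hs
  refine ⟨(prod.lift (terminal.from _ ≫ G.one) (𝟙 _)).left s, ?_, ?_⟩
  · rw [Set.mem_preimage, ← left_comp_apply, prod.lift_snd]
    simpa using hs
  · rw [← left_comp_apply, x.one_act]
    simp

theorem exists_compact_open {X : Scheme.{u}} {K : Set X} (hK : IsCompact K) (W : X.Opens)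
    (hKW : K ⊆ W) : ∃ U : X.Opens, IsCompact (U : Set X) ∧ K ⊆ U ∧ U ≤ W := by
  refine hK.induction_on (p := fun s => ∃ U : X.Opens, IsCompact (U : Set X) ∧ s ⊆ U ∧ U ≤ W)
    ⟨⊥, by simp, by simp, bot_le⟩ ?_ ?_ ?_
  · rintro s t hst ⟨U, h1, h2, h3⟩
    exact ⟨U, h1, hst.trans h2, h3⟩
  · rintro s t ⟨U, h1, h2, h3⟩ ⟨U', h1', h2', h3'⟩
    exact ⟨U ⊔ U', by simpa using h1.union h1', by simpa using Set.union_subset_union h2 h2',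
      sup_le h3 h3'⟩
  · intro y hy
    obtain ⟨U, hU, hyU, hUW⟩ := exists_isAffineOpen_mem_and_subset (hKW hy)
    exact ⟨U, mem_nhdsWithin_of_mem_nhds (U.2.mem_nhds hyU), U, hU.isCompact, le_rfl, hUW⟩

theorem invSet_coborder (hG : G.FlatFinPres) (x : GScheme B G) {S : Set x.carrier.left}
    (h : InvSet x S) : InvSet x (coborder S) := by
  intro p hp
  have h1 := h.iff p
  have h2 := (h.closure hG).iff p
  simp only [coborder, Set.mem_compl_iff, Set.mem_sdiff] at hp ⊢
  rw [h1, h2]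
  exact hp

end Helpers

/-- Let `G` be a flat, finitely presented group scheme over `B`, let `X` be
a `G`-scheme and `V ⊆ X` a `G`-invariant subscheme.  Then the largest open subset of `X`
in which `V` is closed is `G`-invariant; and if moreover `V` is quasi-compact, there is a
quasi-compact `G`-invariant open subscheme of `X` in which `V` is closed. -/
theorem largest_open_where_closed_is_invariant
    {B : Scheme.{u}} {G : GrpOver B} (hG : G.FlatFinPres) (x : GScheme B G)
    {V : Scheme.{u}} (ι : V ⟶ x.sch) (hι : IsImmersion ι) (hinv : IsInvariantSub x ι) :
    (∀ W : x.sch.Opens,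
      (ClosedInOpen ι W ∧ ∀ U : x.sch.Opens, ClosedInOpen ι U → U ≤ W) →
      IsInvariantOpen x W) ∧
    (CompactSpace V →
      ∃ U : x.sch.Opens, IsCompact (U : Set x.sch) ∧ IsInvariantOpen x U ∧
        ClosedInOpen ι U) := by
  have hS := invSet_range x ι hinv
  have hlc : IsLocallyClosed (Set.range ι) := ι.isLocallyClosed_range
  have hW := invSet_coborder hG x hS
  let C : x.carrier.left.Opens := ⟨coborder (Set.range ι), hlc.isOpen_coborder⟩
  have hC : ClosedInOpen ι C := by
    refine ⟨subset_coborder, ?_⟩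
    exact (closure_inter_coborder (s := Set.range ι)).le
  have hmax : ∀ U : x.sch.Opens, ClosedInOpen ι U → U ≤ C := by
    intro U hU y hy hy'
    exact hy'.2 (hU.2 ⟨hy'.1, hy⟩)
  refine ⟨fun W hWm => ?_, fun hV => ?_⟩
  · have : W = C := le_antisymm (hmax W hWm.1) (hWm.2 C hC)
    rw [this]
    exact invariantOpen_of x C hW
  · obtain ⟨U₀, hc, hVU, hUC⟩ := exists_compact_open (X := x.carrier.left)
      (isCompact_range ι.continuous) C hC.1
    let s : (G.carrier ⨯ x.carrier).left ⟶ x.carrier.left :=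
      (prod.snd : G.carrier ⨯ x.carrier ⟶ _).left
    have : QuasiCompact G.carrier.hom := hG.2.2.1
    have hqc : QuasiCompact s :=
      MorphismProperty.of_isPullback (isPullback_prod G.carrier x.carrier) this
    let U : x.carrier.left.Opens := ⟨x.act.left '' (s ⁻¹' (U₀ : Set x.carrier.left)),
      isOpenMap_act hG x _ (U₀.2.preimage s.continuous)⟩
    have hUC' : U ≤ C := by
      rintro _ ⟨q, hq, rfl⟩
      exact hW q (hUC hq)
    refine ⟨U, ?_, invariantOpen_of x U (invSet_orbit x _), ?_, ?_⟩
    · exact (QuasiCompact.isCompact_preimage (f := s) _ U₀.2 hc).image (Scheme.Hom.continuous _)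
    · exact Set.Subset.trans hVU (subset_orbit x _)
    · exact fun y hy => hC.2 ⟨hy.1, hUC' hy.2⟩

end EquivariantSix
end
end

section
/- Let G be a flat, finitely presented group scheme over a scheme B, let X be a G-scheme, and let V ⊆ X be a G-invariant subscheme such that the immersion V ↪ X is quasi-compact. Then the schematic closure of V in X is G-invariant. If moreover X is quasi-compact and quasi-separated and the immersion V ↪ X is of finite presentation, then there exists a finitely presented G-invariant closed subscheme of X in which V is an open subscheme. -/
open CategoryTheory CategoryTheory.Limits AlgebraicGeometry

noncomputable section

namespace EquivariantSix

universe u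

/-- `ι : Z ⟶ X` is the schematic image (schematic closure, when the morphism is a subscheme
inclusion) of `f : T ⟶ X`: the smallest closed subscheme of `X` through which `f` factors. -/
structure IsSchematicImage {T X Z : Scheme.{u}} (f : T ⟶ X) (ι : Z ⟶ X) : Prop where
  isClosedImmersion : IsClosedImmersion ι
  factors : ∃ g : T ⟶ Z, g ≫ ι = f
  isSmallest : ∀ {W : Scheme.{u}} (ι' : W ⟶ X), IsClosedImmersion ι' →
    (∃ g : T ⟶ W, g ≫ ι' = f) → ∃ h : Z ⟶ W, h ≫ ι' = ι

section Helpers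

open Scheme

lemma mem_map_iff_sum {A C : Type u} [CommRing A] [CommRing C] (f : A →+* C)
    (I : Ideal A) (x : C) : x ∈ I.map f ↔
      ∃ (n : ℕ) (c : Fin n → C) (i : Fin n → A), (∀ m, i m ∈ I) ∧ x = ∑ m, c m * f (i m) := by
  constructor
  · intro h
    obtain ⟨n, c, g, h⟩ := Submodule.mem_span_set'.1 h
    choose i hi hi' using fun m => (g m).2
    exact ⟨n, c, i, hi, by rw [← h]; simp [hi']⟩
  · rintro ⟨n, c, i, hi, rfl⟩
    exact Ideal.sum_mem _ fun m _ => Ideal.mul_mem_left _ _ (Ideal.mem_map_of_mem _ (hi m))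

/-- `FL`. -/
lemma flat_colon {A C : Type u} [CommRing A] [CommRing C] (f : A →+* C) (hf : f.Flat)
    (I M L : Ideal A) (s : A) (hL : ∀ y ∈ I, s * y ∈ M → y ∈ L) (x : C) (hx : x ∈ I.map f)
    (hs : f s * x ∈ M.map f) : x ∈ L.map f := by
  obtain ⟨n, c, i, hi, rfl⟩ := (mem_map_iff_sum _ _ _).1 hx
  obtain ⟨n', d, j, hj, e⟩ := (mem_map_iff_sum _ _ _).1 hs
  letI := f.toAlgebra
  haveI : Module.Flat A C := hf
  have key := Module.Flat.isTrivialRelation_of_sum_smul_eq_zero (R := A) (M := C)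
    (ι := Fin n ⊕ Fin n') (f := Sum.elim (fun m => s * i m) (fun m => - j m))
    (x := Sum.elim c d) (by
      simp only [Fintype.sum_sum_type, Sum.elim_inl, Sum.elim_inr, Algebra.smul_def]
      simp only [RingHom.algebraMap_toAlgebra, map_neg, map_mul, neg_mul, Finset.sum_neg_distrib]
      rw [Finset.mul_sum] at e
      rw [add_neg_eq_zero]
      convert e using 2 <;> ring)
  obtain ⟨k, a, y, h1, h2⟩ := key
  have : ∑ m, c m * f (i m) = ∑ l, y l * f (∑ m, a (Sum.inl m) l * i m) := by
    have h1' : ∀ m, c m = ∑ l, f (a (Sum.inl m) l) * y l := fun m => by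
      simpa [Algebra.smul_def, RingHom.algebraMap_toAlgebra] using h1 (Sum.inl m)
    simp_rw [map_sum, Finset.mul_sum, h1', Finset.sum_mul]
    rw [Finset.sum_comm]
    refine Finset.sum_congr rfl fun _ _ => Finset.sum_congr rfl fun _ _ => ?_
    rw [map_mul]; ring
  rw [this]
  refine Ideal.sum_mem _ fun l _ => Ideal.mul_mem_left _ _ (Ideal.mem_map_of_mem _ (hL _ ?_ ?_))
  · exact Ideal.sum_mem _ fun m _ => Ideal.mul_mem_left _ _ (hi m)
  · have := h2 l
    simp only [Fintype.sum_sum_type, Sum.elim_inl, Sum.elim_inr, neg_mul, Finset.sum_neg_distrib,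
      smul_eq_mul, mul_neg] at this
    rw [add_neg_eq_zero] at this
    have e2 : s * ∑ m, a (Sum.inl m) l * i m = ∑ m, a (Sum.inl m) l * (s * i m) := by
      rw [Finset.mul_sum]; exact Finset.sum_congr rfl fun _ _ => by ring
    rw [e2]
    have e3 : ∑ m, a (Sum.inl m) l * (s * i m) = ∑ m, a (Sum.inr m) l * j m := by
      convert this using 2 <;> ring
    rw [e3]
    exact Ideal.sum_mem _ fun m _ => Ideal.mul_mem_left _ _ (hj m)

lemma flat_map_inf {A C : Type u} [CommRing A] [CommRing C] (f : A →+* C) (hf : f.Flat)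
    (I J : Ideal A) : I.map f ⊓ J.map f ≤ (I ⊓ J).map f := by
  rintro x ⟨h1, h2⟩
  exact flat_colon f hf I J (I ⊓ J) 1 (fun y hy hy' => ⟨hy, by simpa using hy'⟩) x h1 (by simpa)

lemma exists_functional {D M : Type u} [CommRing D] [IsDomain D] [AddCommGroup M] [Module D M]
    {n : ℕ} (c : Fin n → M) (hc : LinearIndependent D c) (j₀ : Fin n) :
    ∃ l : M →ₗ[D] FractionRing D, ∀ j, l (c j) = if j = j₀ then 1 else 0 := by
  let V := LocalizedModule (nonZeroDivisors D) M
  have h : LinearIndependent (FractionRing D) (LocalizedModule.mkLinearMap (nonZeroDivisors D) M ∘ c) :=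
    LinearIndependent.of_isLocalizedModule (Rₛ := FractionRing D) (nonZeroDivisors D) _ hc
  let b := Module.Basis.span h
  obtain ⟨g, hg⟩ := LinearMap.exists_extend (b.coord j₀)
  refine ⟨(g.restrictScalars D).comp (LocalizedModule.mkLinearMap (nonZeroDivisors D) M), fun j => ?_⟩
  have := LinearMap.congr_fun hg (b j)
  simp only [LinearMap.comp_apply, Module.Basis.coord_apply, Module.Basis.repr_self] at this
  rw [Finsupp.single_apply] at this
  rw [← this, LinearMap.comp_apply, LinearMap.restrictScalars_apply]
  congr 1
  simp [b, Module.Basis.span_apply]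

/-- second half of `PR`. -/
lemma pr_ring_two {R C A E : Type u} [CommRing R] [CommRing C] [CommRing A] [CommRing E]
    [Algebra R C] [Algebra R A] [Algebra R E] [Algebra A E] [IsScalarTower R A E]
    (τ : C →ₗ[R] E) (hτ : IsBaseChange A τ) (hflat : (algebraMap A E).Flat)
    (p : Ideal R) [p.IsPrime] {n : ℕ} (c : Fin n → C)
    (hc : LinearIndependent (R ⧸ p) (fun m => Submodule.Quotient.mk (p := p • (⊤ : Submodule R C)) (c m)))
    (i : Fin n → A) (N : Ideal A) (hp : ∀ r ∈ p, ∀ m, algebraMap R A r * i m ∈ N)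
    (h : ∑ m, τ (c m) * algebraMap A E (i m) ∈ N.map (algebraMap A E)) :
    ∃ t ∉ p, ∀ m, algebraMap R A t * i m ∈ N := by
  suffices H : ∀ m, ∃ t ∉ p, algebraMap R A t * i m ∈ N by
    choose t ht ht' using H
    refine ⟨∏ m, t m, fun h => ?_, fun m => ?_⟩
    · obtain ⟨m, -, hm⟩ := (Ideal.IsPrime.prod_mem_iff ).1 h
      exact ht m hm
    · rw [← Finset.prod_erase_mul _ _ (Finset.mem_univ m), map_mul, mul_assoc]
      exact Ideal.mul_mem_left _ _ (ht' m)
  intro j₀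
  obtain ⟨l, hl⟩ := exists_functional _ hc j₀
  -- the localisation
  let pA : Ideal A := p.map (algebraMap R A)
  let φ : R →+* A ⧸ pA := (Ideal.Quotient.mk pA).comp (algebraMap R A)
  let S : Submonoid (A ⧸ pA) := p.primeCompl.map φ
  let L := Localization S
  let θ₀ : R ⧸ p →+* L := (algebraMap (A ⧸ pA) L).comp (Ideal.Quotient.lift p φ (fun r hr => by
    simp only [φ, RingHom.comp_apply, Ideal.Quotient.eq_zero_iff_mem]
    exact Ideal.mem_map_of_mem _ hr))
  have hθ₀ : ∀ y : nonZeroDivisors (R ⧸ p), IsUnit (θ₀ y) := by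
    rintro ⟨y, hy⟩
    obtain ⟨r, rfl⟩ := Ideal.Quotient.mk_surjective y
    have hr : r ∉ p := fun h => by
      rw [Ideal.Quotient.eq_zero_iff_mem.2 h] at hy
      exact nonZeroDivisors.ne_zero hy rfl
    have : θ₀ (Ideal.Quotient.mk p r) = algebraMap (A ⧸ pA) L (φ r) := by simp [θ₀]
    simp only [this]
    exact IsLocalization.map_units L (⟨φ r, r, hr, rfl⟩ : S)
  let θ : FractionRing (R ⧸ p) →+* L := IsLocalization.lift hθ₀
  have hθ : ∀ r : R, ∀ x, θ (Ideal.Quotient.mk p r • x) = r • θ x := fun r x => by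
    rw [Algebra.smul_def, map_mul, IsLocalization.lift_eq, Algebra.smul_def]
    rfl
  let g : C →ₗ[R] L :=
    { toFun := fun x => θ (l (Submodule.Quotient.mk x))
      map_add' := fun x y => by rw [Submodule.Quotient.mk_add, map_add, map_add]
      map_smul' := fun r x => by
        rw [RingHom.id_apply, ← hθ, ← map_smul]
        rfl }
  let G : E →ₗ[A] L := hτ.lift g
  have hG : ∀ m, G (τ (c m)) = if m = j₀ then 1 else 0 := fun m => by
    have : G (τ (c m)) = θ (l (Submodule.Quotient.mk (c m))) := hτ.lift_eq g _
    rw [this, hl]; split_ifs <;> simp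
  -- the relation
  obtain ⟨n', d, j, hj, e⟩ := (mem_map_iff_sum _ _ _).1 h
  have : Module.Flat A E := by
    have h := hflat
    rw [RingHom.Flat] at h
    convert h
    rw [Algebra.algebra_ext_iff]
    intro; rfl
  have key := Module.Flat.isTrivialRelation_of_sum_smul_eq_zero (R := A) (M := E)
    (ι := Fin n ⊕ Fin n') (f := Sum.elim i (fun m => - j m))
    (x := Sum.elim (fun m => τ (c m)) d) (by
      simp only [Fintype.sum_sum_type, Sum.elim_inl, Sum.elim_inr, Algebra.smul_def]
      simp only [map_neg, neg_mul, Finset.sum_neg_distrib]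
      rw [add_neg_eq_zero]
      convert e using 2 <;> ring)
  obtain ⟨k, a, y, h1, h2⟩ := key
  -- lift `G (y l)`
  have hlift : ∀ w : L, ∃ t ∉ p, ∃ z : A, algebraMap A L (algebraMap R A t) * w = algebraMap A L z := by
    intro w
    obtain ⟨⟨x, ⟨_, t, ht, rfl⟩⟩, hx⟩ := IsLocalization.surj S w
    obtain ⟨z, rfl⟩ := Ideal.Quotient.mk_surjective x
    exact ⟨t, ht, z, by rw [mul_comm]; exact hx⟩
  choose t ht z hz using fun l => hlift (G (y l))
  let T := ∏ l, t l
  have hT : T ∉ p := fun h => by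
    obtain ⟨m, -, hm⟩ := (Ideal.IsPrime.prod_mem_iff).1 h
    exact ht m hm
  let z' : Fin k → A := fun l => algebraMap R A (∏ l' ∈ Finset.univ.erase l, t l') * z l
  have hz' : ∀ l, algebraMap A L (algebraMap R A T) * G (y l) = algebraMap A L (z' l) := fun l => by
    simp only [z', map_mul, ← hz, T]
    rw [← Finset.prod_erase_mul _ _ (Finset.mem_univ l)]
    simp only [map_mul]; ring
  have hrel : ∀ m, algebraMap A L ((if m = j₀ then algebraMap R A T else 0) - ∑ l, a (Sum.inl m) l * z' l) = 0 := by
    intro m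
    have h1m := h1 (Sum.inl m)
    simp only [Sum.elim_inl] at h1m
    have := congrArg (fun x => algebraMap A L (algebraMap R A T) * G x) h1m
    simp only [hG, map_sum, map_smul, Finset.mul_sum] at this
    rw [map_sub, sub_eq_zero, map_sum]
    calc _ = algebraMap A L (algebraMap R A T) * (if m = j₀ then 1 else 0) := by split_ifs <;> simp
      _ = _ := this
      _ = _ := Finset.sum_congr rfl fun l _ => by
          rw [map_mul, ← hz', Algebra.smul_def]; ring
  have hdet : ∀ x : A, algebraMap A L x = 0 → ∃ u ∉ p, algebraMap R A u * x ∈ pA := by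
    intro x hx
    have hx : algebraMap (A ⧸ pA) L (Ideal.Quotient.mk pA x) = 0 := hx
    obtain ⟨⟨_, u, hu, rfl⟩, hx⟩ := (IsLocalization.map_eq_zero_iff S L _).1 hx
    refine ⟨u, hu, ?_⟩
    rw [← Ideal.Quotient.eq_zero_iff_mem, map_mul]
    exact hx
  choose u hu hu' using fun m => hdet _ (hrel m)
  let W := ∏ l, u l
  have hW : W ∉ p := fun h => by
    obtain ⟨m, -, hm⟩ := (Ideal.IsPrime.prod_mem_iff).1 h
    exact hu m hm
  have hW' : ∀ m, algebraMap R A W * ((if m = j₀ then algebraMap R A T else 0) - ∑ l, a (Sum.inl m) l * z' l) ∈ pA := by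
    intro m
    simp only [W]
    rw [← Finset.prod_erase_mul _ _ (Finset.mem_univ m), map_mul, mul_assoc]
    exact Ideal.mul_mem_left _ _ (hu' m)
  have hpA : ∀ x ∈ pA, ∀ m, x * i m ∈ N := by
    intro x hx m
    obtain ⟨q, c', r, hr, rfl⟩ := (mem_map_iff_sum _ _ _).1 hx
    rw [Finset.sum_mul]
    refine Ideal.sum_mem _ fun _ _ => ?_
    rw [mul_assoc]
    exact Ideal.mul_mem_left _ _ (hp _ (hr _) m)
  refine ⟨W * T, fun h => (‹p.IsPrime›.mem_or_mem h).elim hW hT, ?_⟩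
  have hsum : algebraMap R A (W * T) * i j₀ =
      ∑ m, (algebraMap R A W * ((if m = j₀ then algebraMap R A T else 0) - ∑ l, a (Sum.inl m) l * z' l)) * i m
      + algebraMap R A W * ∑ l, (∑ m, i m * a (Sum.inl m) l) * z' l := by
    simp_rw [mul_assoc, ← Finset.mul_sum, sub_mul, Finset.sum_sub_distrib, Finset.sum_mul, mul_sub]
    rw [Finset.sum_comm]
    simp [map_mul, mul_assoc]
    congr 1
    simp only [← mul_assoc, Finset.mul_sum]
    rw [eq_comm, sub_add_eq_add_sub, sub_eq_iff_eq_add]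
    refine congrArg _ (Finset.sum_congr rfl fun _ _ => Finset.sum_congr rfl fun _ _ => by ring)
  rw [hsum]
  refine Ideal.add_mem _ (Ideal.sum_mem _ fun m _ => hpA _ (hW' m) m) (Ideal.mul_mem_left _ _
    (Ideal.sum_mem _ fun l _ => Ideal.mul_mem_right _ _ ?_))
  have := h2 l
  simp only [Fintype.sum_sum_type, Sum.elim_inl, Sum.elim_inr, neg_mul, Finset.sum_neg_distrib] at this
  rw [add_neg_eq_zero] at this
  rw [this]
  exact Ideal.sum_mem _ fun m _ => Ideal.mul_mem_right _ _ (hj m)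

/-- first half of `PR`. -/
lemma pr_ring_one {R C A E : Type u} [CommRing R] [CommRing C] [CommRing A] [CommRing E]
    [Algebra R C] [Algebra R A] [Algebra R E] [Algebra A E] [IsScalarTower R A E]
    (τ : C →ₗ[R] E) (hτ : IsBaseChange A τ)
    (p : Ideal R) [p.IsPrime] (I : Ideal A) (k : E) (hk : k ∈ I.map (algebraMap A E)) :
    ∃ (n : ℕ) (c : Fin n → C) (i : Fin n → A) (s : R), s ∉ p ∧ (∀ m, i m ∈ I) ∧
      algebraMap A E (algebraMap R A s) * k - ∑ m, τ (c m) * algebraMap A E (i m) ∈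
        (p.map (algebraMap R A) * I).map (algebraMap A E) ∧
      LinearIndependent (R ⧸ p)
        (fun m => Submodule.Quotient.mk (p := p • (⊤ : Submodule R C)) (c m)) := by
  classical
  let Rep : ℕ → Prop := fun n => ∃ (c : Fin n → C) (i : Fin n → A) (s : R), s ∉ p ∧
      (∀ m, i m ∈ I) ∧
      algebraMap A E (algebraMap R A s) * k - ∑ m, τ (c m) * algebraMap A E (i m) ∈
        (p.map (algebraMap R A) * I).map (algebraMap A E)
  have hex : ∃ n, Rep n := by
    have : k ∈ Submodule.span R {z | ∃ c : C, ∃ i ∈ I, z = τ c * algebraMap A E i} := by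
      obtain ⟨n, x, i, hi, rfl⟩ := (mem_map_iff_sum _ _ _).1 hk
      refine Submodule.sum_mem _ fun m _ => ?_
      have : ∀ i ∈ I, x m * algebraMap A E i ∈
          Submodule.span R {z | ∃ c : C, ∃ i ∈ I, z = τ c * algebraMap A E i} := by
        refine hτ.inductionOn (x m) _ ?_ ?_ ?_ ?_
        · intro i _; simp
        · intro c i hi; exact Submodule.subset_span ⟨c, i, hi, rfl⟩
        · intro a y hy i hi
          have := hy (a * i) (I.mul_mem_left _ hi)
          rwa [map_mul, mul_left_comm, ← mul_assoc, ← Algebra.smul_def] at this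
        · intro y z hy hz i hi
          rw [add_mul]; exact Submodule.add_mem _ (hy i hi) (hz i hi)
      exact this _ (hi m)
    obtain ⟨n, r, g, h⟩ := Submodule.mem_span_set'.1 this
    choose c i hi hi' using fun m => (g m).2
    refine ⟨n, fun m => r m • c m, i, 1, fun h => ‹p.IsPrime›.ne_top (p.eq_top_iff_one.2 h), hi, ?_⟩
    rw [← h]
    simp [hi']
  obtain ⟨c, i, s, hs, hi, h⟩ := Nat.find_spec hex
  have hmin := fun m hm => Nat.find_min hex (m := m) hm
  generalize Nat.find hex = n at *
  refine ⟨n, c, i, s, hs, hi, h, ?_⟩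
  rw [Fintype.linearIndependent_iff]
  intro g hg
  by_contra! hne
  obtain ⟨j, hj⟩ := hne
  choose r hr using fun m => Ideal.Quotient.mk_surjective (g m)
  have hrj : r j ∉ p := fun h => hj (by rw [← hr, Ideal.Quotient.eq_zero_iff_mem.2 h])
  have hsum : ∑ m, r m • c m ∈ p • (⊤ : Submodule R C) := by
    rw [← Submodule.Quotient.mk_eq_zero, ← hg, ← Submodule.mkQ_apply, map_sum]
    refine Finset.sum_congr rfl fun m _ => ?_
    rw [← hr m]
    rfl
  obtain ⟨n, rfl⟩ : ∃ n', n = n' + 1 := ⟨n - 1, by have := j.2; omega⟩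
  refine hmin n (Nat.lt_succ_self n) ⟨fun m => c (j.succAbove m),
    fun m => algebraMap R A (r j) * i (j.succAbove m) - algebraMap R A (r (j.succAbove m)) * i j,
    r j * s, fun h => (‹p.IsPrime›.mem_or_mem h).elim hrj hs, fun m => I.sub_mem
      (I.mul_mem_left _ (hi _)) (I.mul_mem_left _ (hi _)), ?_⟩
  have hx : τ (∑ m, r m • c m) * algebraMap A E (i j) ∈
      (p.map (algebraMap R A) * I).map (algebraMap A E) := by
    refine Submodule.smul_induction_on hsum ?_ ?_
    · intro q hq y _
      rw [map_smul, Algebra.smul_def, IsScalarTower.algebraMap_apply R A E,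
        mul_right_comm, ← map_mul]
      exact Ideal.mul_mem_right _ _ (Ideal.mem_map_of_mem _
        (Ideal.mul_mem_mul (Ideal.mem_map_of_mem _ hq) (hi j)))
    · intro y z hy hz
      rw [map_add, add_mul]; exact Ideal.add_mem _ hy hz
  have := Ideal.add_mem _ (Ideal.mul_mem_left _ (algebraMap A E (algebraMap R A (r j))) h) hx
  convert this using 1
  rw [Fin.sum_univ_succAbove _ j, Fin.sum_univ_succAbove _ j]
  have e0 : ∀ (q : R) (y : C), τ (q • y) = algebraMap A E (algebraMap R A q) * τ y := fun q y => by
    rw [map_smul, Algebra.smul_def, IsScalarTower.algebraMap_apply R A E]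
  simp only [map_mul, map_sub, map_add, map_sum, mul_sub, Finset.sum_sub_distrib, e0, mul_add, add_mul, Finset.mul_sum,
    Finset.sum_mul]
  have e1 : ∀ m, τ (c (j.succAbove m)) * ((algebraMap A E) ((algebraMap R A) (r j)) *
      (algebraMap A E) (i (j.succAbove m))) = (algebraMap A E) ((algebraMap R A) (r j)) *
      (τ (c (j.succAbove m)) * (algebraMap A E) (i (j.succAbove m))) := fun m => by ring
  have e2 : ∀ m, τ (c (j.succAbove m)) * ((algebraMap A E) ((algebraMap R A) (r (j.succAbove m))) *
      (algebraMap A E) (i j)) = (algebraMap A E) ((algebraMap R A) (r (j.succAbove m))) *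
      τ (c (j.succAbove m)) * (algebraMap A E) (i j) := fun m => by ring
  simp only [e1, e2]
  ring

lemma ideal_comap_ι {X : Scheme.{u}} (I : X.IdealSheafData) (U : X.affineOpens)
    (h : IsAffineOpen (⊤ : U.1.toScheme.Opens)) (h' : (⊤ : U.1.toScheme.Opens) ≤ U.1.ι ⁻¹ᵁ U.1) :
    (I.comap U.1.ι).ideal ⟨⊤, h⟩ = (I.ideal U).map (U.1.ι.appLE U ⊤ h').hom := by
  rw [IdealSheafData.ideal_comap_of_isOpenImmersion]
  have hV : U.1.ι ''ᵁ ⊤ ≤ U.1 := by simp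
  rw [← I.map_ideal (U := ⟨U.1.ι ''ᵁ ⊤, h.image_of_isOpenImmersion _⟩) (V := U) hV]
  have := Ideal.comap_symm (I := Ideal.map (X.presheaf.map (homOfLE hV).op).hom (I.ideal U)) (U.1.ι.appIso ⊤).commRingCatIsoToRingEquiv
  refine this.trans ?_
  change Ideal.map (U.1.ι.appIso ⊤).hom.hom _ = _
  rw [Ideal.map_map, ← CommRingCat.hom_comp, Scheme.Hom.appIso_hom', Scheme.Hom.map_appLE]

lemma ideal_comap_of_isAffine {X Y : Scheme.{u}} [IsAffine X] [IsAffine Y] (f : Y ⟶ X)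
    (I : X.IdealSheafData) :
    (I.comap f).ideal ⟨⊤, isAffineOpen_top Y⟩ =
      (I.ideal ⟨⊤, isAffineOpen_top X⟩).map (f.appTop).hom := by
  apply le_antisymm
  · let J : Y.IdealSheafData := IdealSheafData.ofIdealTop
      ((I.ideal ⟨⊤, isAffineOpen_top X⟩).map (f.appTop).hom)
    have hJ : J.ideal ⟨⊤, isAffineOpen_top Y⟩ = (I.ideal ⟨⊤, isAffineOpen_top X⟩).map (f.appTop).hom := by
      simp [J]
    rw [← hJ]
    have : I.comap f ≤ J := by
      rw [← IdealSheafData.le_map_iff_comap_le]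
      apply IdealSheafData.le_of_isAffine
      rw [IdealSheafData.ideal_map_of_isAffineHom]
      rw [← Ideal.map_le_iff_le_comap]
      exact hJ.ge
    exact this _
  · rw [Ideal.map_le_iff_le_comap]
    have : I ≤ (I.comap f).map f := (IdealSheafData.le_map_iff_comap_le).2 le_rfl
    have := this ⟨⊤, isAffineOpen_top X⟩
    rw [IdealSheafData.ideal_map_of_isAffineHom] at this
    exact this

/-- `L1`. -/
lemma ideal_comap {X Y : Scheme.{u}} (f : Y ⟶ X) (I : X.IdealSheafData) (U : X.affineOpens)
    (Q : Y.affineOpens) (h : Q.1 ≤ f ⁻¹ᵁ U.1) :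
    (I.comap f).ideal Q = (I.ideal U).map (f.appLE U Q h).hom := by
  have : IsAffine U.1 := U.2
  have : IsAffine Q.1 := Q.2
  have e : (I.comap f).comap Q.1.ι = (I.comap U.1.ι).comap (f.resLE U Q h) := by
    rw [← IdealSheafData.comap_comp, ← IdealSheafData.comap_comp, Scheme.Hom.resLE_comp_ι]
  have e2 := congrArg (fun J => J.ideal ⟨⊤, isAffineOpen_top _⟩) e
  simp only at e2
  rw [ideal_comap_ι _ _ _ (by simp), ideal_comap_of_isAffine, ideal_comap_ι _ _ _ (by simp), Ideal.map_map] at e2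
  rw [← CommRingCat.hom_comp] at e2
  have hQ : (⊤ : Q.1.toScheme.Opens) ≤ Q.1.ι ⁻¹ᵁ Q.1 := by simp
  have hiso : IsIso (Q.1.ι.appLE Q ⊤ hQ) := by
    rw [Scheme.Opens.ι_appLE]
    exact (Y.presheaf.mapIso (eqToIso (show Q.1.ι ''ᵁ ⊤ = Q.1 by simp)).op).isIso_hom
  have inj : Function.Injective (Ideal.map (Q.1.ι.appLE Q ⊤ hQ).hom) := by
    intro I J h
    have := congrArg (Ideal.map (inv (Q.1.ι.appLE Q ⊤ hQ)).hom) h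
    simpa only [Ideal.map_map, ← CommRingCat.hom_comp, IsIso.hom_inv_id, CommRingCat.hom_id, Ideal.map_id] using this
  apply inj
  rw [e2, Ideal.map_map, ← CommRingCat.hom_comp]
  congr 2
  have e4 : (f.resLE U Q h).appTop = (f.resLE U Q h).appLE ⊤ ⊤ le_top :=
    Scheme.Hom.app_eq_appLE _
  refine (congrArg _ e4).trans ((Scheme.Hom.appLE_comp_appLE _ _ _ _ _ _ _).trans ?_)
  refine Eq.trans ?_ (Scheme.Hom.appLE_comp_appLE _ _ _ _ _ _ _).symm
  simp only [Scheme.Hom.resLE_comp_ι]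

lemma le_of_point {X : Scheme.{u}} (I J : X.IdealSheafData)
    (h : ∀ x : X, ∃ U : X.affineOpens, x ∈ U.1 ∧ I.ideal U ≤ J.ideal U) : I ≤ J := by
  choose U hx hU using h
  refine IdealSheafData.le_of_iSup_eq_top U ?_ hU
  rw [eq_top_iff]
  exact fun x _ => TopologicalSpace.Opens.mem_iSup.2 ⟨x, hx x⟩

lemma exists_affine_le {X : Scheme.{u}} (x : X) (U : X.Opens) (hx : x ∈ U) :
    ∃ V : X.affineOpens, x ∈ V.1 ∧ V.1 ≤ U := by
  obtain ⟨_, ⟨V, hV, rfl⟩, hxV, h⟩ := X.isBasis_affineOpens.exists_subset_of_mem_open hx U.2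
  exact ⟨⟨V, hV⟩, hxV, h⟩

lemma toImage_dominant {X Y : Scheme.{u}} (f : X ⟶ Y) [QuasiCompact f] :
    IsSchemeTheoreticallyDominant f.toImage := by
  refine ⟨le_bot_iff.1 (le_of_point _ _ fun x => ?_)⟩
  obtain ⟨U, hxU, -⟩ := exists_affine_le (f.imageι x) ⊤ trivial
  refine ⟨⟨f.imageι ⁻¹ᵁ U.1, U.2.preimage _⟩, hxU, ?_⟩
  rw [Hom.ker_apply, (RingHom.injective_iff_ker_eq_bot _).1 (f.toImage_app_injective U)]
  exact bot_le

/-- `FBC`. -/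
lemma comap_ker_flat {X P T : Scheme.{u}} (p : P ⟶ X) [Flat p] (f : T ⟶ X) [QuasiCompact f] :
    f.ker.comap p = (pullback.fst p f).ker := by
  let h : pullback p f ⟶ pullback p f.imageι :=
    pullback.lift (pullback.fst _ _) (pullback.snd _ _ ≫ f.toImage) (by
      rw [Category.assoc, f.toImage_imageι, pullback.condition])
  have hh : h ≫ pullback.fst _ _ = pullback.fst p f := pullback.lift_fst _ _ _
  have s : IsPullback (h ≫ pullback.fst p f.imageι) (pullback.snd p f) p (f.toImage ≫ f.imageι) := by
    rw [hh, f.toImage_imageι]; exact IsPullback.of_hasPullback _ _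
  have s2 := IsPullback.of_right s (pullback.lift_snd _ _ _) (IsPullback.of_hasPullback p f.imageι)
  have := toImage_dominant f
  have := IsSchemeTheoreticallyDominant.of_isPullback s2.flip
  rw [← hh, Hom.ker_comp, h.ker_eq_bot, IdealSheafData.map_bot]
  rfl

lemma comap_inf_flat {X P : Scheme.{u}} (p : P ⟶ X) [Flat p] (I J : X.IdealSheafData) :
    (I ⊓ J).comap p = I.comap p ⊓ J.comap p := by
  apply le_antisymm
  · exact le_inf (IdealSheafData.comap_mono p inf_le_left) (IdealSheafData.comap_mono p inf_le_right)
  · refine le_of_point _ _ fun x => ?_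
    obtain ⟨U, hxU, -⟩ := exists_affine_le (p x) ⊤ trivial
    obtain ⟨Q, hxQ, hQ⟩ := exists_affine_le x (p ⁻¹ᵁ U.1) hxU
    refine ⟨Q, hxQ, ?_⟩
    rw [IdealSheafData.ideal_inf, Pi.inf_apply, ideal_comap p _ U Q hQ, ideal_comap p _ U Q hQ, ideal_comap p _ U Q hQ,
      IdealSheafData.ideal_inf, Pi.inf_apply]
    exact flat_map_inf _ (p.flat_appLE U.2 Q.2 hQ) _ _

/-- Invariance of an ideal sheaf. -/
def Inv {X P : Scheme.{u}} (p a : P ⟶ X) (I : X.IdealSheafData) : Prop := I.comap a ≤ I.comap p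

lemma Inv.inf {X P : Scheme.{u}} {p a : P ⟶ X} [Flat p] {I J : X.IdealSheafData}
    (hI : Inv p a I) (hJ : Inv p a J) : Inv p a (I ⊓ J) := by
  change _ ≤ (I ⊓ J).comap p
  rw [comap_inf_flat p]
  exact le_inf ((IdealSheafData.comap_mono a inf_le_left).trans hI)
    ((IdealSheafData.comap_mono a inf_le_right).trans hJ)

lemma inv_of_lift {X P T : Scheme.{u}} (p a : P ⟶ X) [Flat p] (f : T ⟶ X) [QuasiCompact f]
    (r : pullback p f ⟶ T) (hr : r ≫ f = pullback.fst p f ≫ a) : Inv p a f.ker := by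
  change _ ≤ f.ker.comap p
  rw [comap_ker_flat p, ← IdealSheafData.le_map_iff_comap_le, ← Hom.ker_comp, ← hr]
  exact Hom.le_ker_comp _ _

/-- groupoid-like data -/
structure Gpd (X P : Scheme.{u}) where
  p : P ⟶ X
  a : P ⟶ X
  e : X ⟶ P
  m : pullback p a ⟶ P
  e_p : e ≫ p = 𝟙 X
  e_a : e ≫ a = 𝟙 X
  m_p : m ≫ p = pullback.snd p a ≫ p
  m_a : m ≫ a = pullback.fst p a ≫ a
  flat : Flat p
  qc_a : QuasiCompact a
  qcs : CompactSpace X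
  qs : QuasiSeparatedSpace X

variable {X P : Scheme.{u}} (D : Gpd X P)

def Lam (J : X.IdealSheafData) : X.IdealSheafData := (J.comap D.p).map D.a

lemma le_Lam {E J : X.IdealSheafData} : E ≤ Lam D J ↔ E.comap D.a ≤ J.comap D.p :=
  IdealSheafData.le_map_iff_comap_le

lemma Lam_le (J : X.IdealSheafData) : Lam D J ≤ J := by
  have := IdealSheafData.comap_mono D.e ((le_Lam D).1 (le_refl (Lam D J)))
  simpa only [← IdealSheafData.comap_comp, D.e_p, D.e_a, IdealSheafData.comap_id] using this

lemma Lam_inv (J : X.IdealSheafData) : Inv D.p D.a (Lam D J) := by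
  have := D.flat
  have := D.qc_a
  have e : Lam D J = (pullback.fst D.p J.subschemeι ≫ D.a).ker := by
    rw [Hom.ker_comp]; rfl
  rw [e]
  set f := pullback.fst D.p J.subschemeι ≫ D.a with hf
  let u : pullback D.p f ⟶ pullback D.p D.a := pullback.lift (pullback.fst _ _)
    (pullback.snd _ _ ≫ pullback.fst _ _) (by rw [Category.assoc, ← hf, pullback.condition])
  have hu1 : u ≫ pullback.fst _ _ = pullback.fst _ _ := pullback.lift_fst _ _ _
  have hu2 : u ≫ pullback.snd _ _ = pullback.snd _ _ ≫ pullback.fst _ _ := pullback.lift_snd _ _ _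
  refine inv_of_lift _ _ _ (pullback.lift (u ≫ D.m) (pullback.snd _ _ ≫ pullback.snd _ _) ?_) ?_
  · rw [Category.assoc, D.m_p, reassoc_of% hu2, Category.assoc, pullback.condition]
  · change pullback.lift _ _ _ ≫ pullback.fst _ _ ≫ D.a = _
    rw [pullback.lift_fst_assoc, Category.assoc, D.m_a, reassoc_of% hu1]

/-- The inclusion of the closed subscheme of an affine open given by an ideal. -/
def zed (U : X.affineOpens) (K : Ideal Γ(X, U.1)) : Spec (.of (Γ(X, U.1) ⧸ K)) ⟶ X :=
  Spec.map (CommRingCat.ofHom (Ideal.Quotient.mk K)) ≫ U.2.fromSpec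

lemma zed_preimage (U : X.affineOpens) (K : Ideal Γ(X, U.1)) : zed U K ⁻¹ᵁ U.1 = ⊤ := by
  rw [zed, Hom.comp_preimage, U.2.fromSpec_preimage_self]; rfl

lemma ker_zed_appLE (U : X.affineOpens) (K : Ideal Γ(X, U.1)) (h) :
    RingHom.ker ((zed U K).appLE U.1 ⊤ h).hom = K := by
  have h1 : (⊤ : (Spec Γ(X, U.1)).Opens) ≤ U.2.fromSpec ⁻¹ᵁ U.1 := by
    rw [U.2.fromSpec_preimage_self]
  have : (zed U K).appLE U.1 ⊤ h = CommRingCat.ofHom (Ideal.Quotient.mk K) ≫ (ΓSpecIso _).inv := by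
    rw [ΓSpecIso_inv_naturality]
    have : U.2.fromSpec.appLE U.1 ⊤ h1 = (ΓSpecIso _).inv := by
      rw [Hom.appLE, U.2.fromSpec_app_self, Category.assoc, ← Functor.map_comp]
      exact (congrArg _ (CategoryTheory.Functor.map_id _ _)).trans (Category.comp_id _)
    refine Eq.trans ?_ (congrArg (· ≫ (Spec.map (CommRingCat.ofHom (Ideal.Quotient.mk K))).appTop) this)
    refine Eq.trans ?_ (congrArg _ (Scheme.Hom.app_eq_appLE _).symm)
    exact (Scheme.Hom.appLE_comp_appLE _ _ _ _ _ _ _).symm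
  rw [this, CommRingCat.hom_comp]
  ext x
  rw [RingHom.mem_ker, RingHom.comp_apply,
    map_eq_zero_iff _ (ConcreteCategory.bijective_of_isIso (ΓSpecIso _).inv).1]
  exact Ideal.Quotient.eq_zero_iff_mem

def ext (U : X.affineOpens) (K : Ideal Γ(X, U.1)) : X.IdealSheafData := (zed U K).ker

lemma le_ext {E : X.IdealSheafData} {U : X.affineOpens} {K : Ideal Γ(X, U.1)} :
    E ≤ ext U K ↔ E.ideal U ≤ K := by
  rw [ext, ← IdealSheafData.map_bot, IdealSheafData.le_map_iff_comap_le]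
  have h : (⊤ : (Spec (.of (Γ(X, U.1) ⧸ K))).Opens) ≤ zed U K ⁻¹ᵁ U.1 := (zed_preimage U K).ge
  have : E.ideal U ≤ K ↔ (E.comap (zed U K)).ideal ⟨⊤, isAffineOpen_top _⟩ ≤ ⊥ := by
    rw [ideal_comap _ _ U ⟨⊤, isAffineOpen_top _⟩ h, Ideal.map_le_iff_le_comap]
    rw [← RingHom.ker_eq_comap_bot, ker_zed_appLE]
  rw [this]
  constructor
  · intro h
    exact (h _).trans (by simp)
  · intro h
    apply IdealSheafData.le_of_isAffine
    exact h.trans bot_le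

lemma ext_mono {U : X.affineOpens} {K K' : Ideal Γ(X, U.1)} (h : K ≤ K') : ext U K ≤ ext U K' :=
  le_ext.2 ((le_ext.1 le_rfl).trans h)

instance [QuasiSeparatedSpace X] (U : X.affineOpens) (K : Ideal Γ(X, U.1)) :
    QuasiCompact (zed U K) := by
  infer_instance

lemma ext_ideal [QuasiSeparatedSpace X] (U : X.affineOpens) (K : Ideal Γ(X, U.1)) :
    (ext U K).ideal U = K := by
  apply le_antisymm (le_ext.1 le_rfl)
  have h : (⊤ : (Spec (.of (Γ(X, U.1) ⧸ K))).Opens) ≤ zed U K ⁻¹ᵁ U.1 := (zed_preimage U K).ge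
  intro x hx
  rw [← ker_zed_appLE U K h] at hx
  rw [ext, Hom.ker_apply]
  have h2 : Function.Injective ((Spec (.of (Γ(X, U.1) ⧸ K))).presheaf.map (homOfLE h).op) := by
    have : IsIso ((Spec (.of (Γ(X, U.1) ⧸ K))).presheaf.map (homOfLE h).op) :=
      ((Spec (.of (Γ(X, U.1) ⧸ K))).presheaf.mapIso (eqToIso (zed_preimage U K).symm).op).isIso_hom
    exact (ConcreteCategory.bijective_of_isIso _).1
  rw [RingHom.mem_ker, Hom.appLE, CommRingCat.hom_comp, RingHom.comp_apply] at hx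
  exact (map_eq_zero_iff _ h2).1 hx

/-- `Crit`. -/
lemma le_comap_ext [QuasiSeparatedSpace X] (p : P ⟶ X) [Flat p] (U : X.affineOpens)
    (K : Ideal Γ(X, U.1)) (F : P.IdealSheafData)
    (H : ∀ x ∈ p ⁻¹ᵁ U.1, ∃ Q : P.affineOpens, ∃ hQ : Q.1 ≤ p ⁻¹ᵁ U.1, x ∈ Q.1 ∧
      F.ideal Q ≤ K.map (p.appLE U.1 Q.1 hQ).hom) : F ≤ (ext U K).comap p := by
  rw [ext, comap_ker_flat, ← IdealSheafData.map_bot, IdealSheafData.le_map_iff_comap_le]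
  refine le_of_point _ _ fun t => ?_
  have hz : (⊤ : (Spec (.of (Γ(X, U.1) ⧸ K))).Opens) ≤ zed U K ⁻¹ᵁ U.1 := (zed_preimage U K).ge
  have ht : pullback.fst p (zed U K) t ∈ p ⁻¹ᵁ U.1 := by
    change p (pullback.fst p (zed U K) t) ∈ U.1
    rw [← Scheme.Hom.comp_apply, pullback.condition, Scheme.Hom.comp_apply]
    exact hz trivial
  obtain ⟨Q, hQ, hx, hF⟩ := H _ ht
  obtain ⟨T, htT, hT⟩ := exists_affine_le t (pullback.fst p (zed U K) ⁻¹ᵁ Q.1) hx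
  refine ⟨T, htT, ?_⟩
  rw [ideal_comap _ _ Q T hT]
  refine (Ideal.map_mono hF).trans ?_
  rw [Ideal.map_map, ← CommRingCat.hom_comp, Scheme.Hom.appLE_comp_appLE]
  simp only [pullback.condition]
  rw [← Scheme.Hom.appLE_comp_appLE _ _ U.1 ⊤ T.1 hz le_top, CommRingCat.hom_comp, ← Ideal.map_map]
  have : K.map ((zed U K).appLE U.1 ⊤ hz).hom = ⊥ := by
    rw [eq_bot_iff, Ideal.map_le_iff_le_comap, ← RingHom.ker_eq_comap_bot, ker_zed_appLE]
  rw [this, Ideal.map_bot]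
  exact bot_le

lemma comap_ext_ideal [QuasiSeparatedSpace X] (p : P ⟶ X) (U : X.affineOpens)
    (K : Ideal Γ(X, U.1)) (Q : P.affineOpens) (hQ : Q.1 ≤ p ⁻¹ᵁ U.1) :
    ((ext U K).comap p).ideal Q = K.map (p.appLE U.1 Q.1 hQ).hom := by
  rw [ideal_comap p _ U Q hQ, ext_ideal]

/-- Ideal sheaf of finite type. -/
def FGS {X : Scheme.{u}} (I : X.IdealSheafData) : Prop := ∀ U : X.affineOpens, (I.ideal U).FG

lemma fg_of_le {X : Scheme.{u}} {I : X.IdealSheafData} {U V : X.affineOpens} (h : U.1 ≤ V.1)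
    (hV : (I.ideal V).FG) : (I.ideal U).FG := by
  rw [← I.map_ideal (U := U) (V := V) h]
  exact hV.map _

lemma fgs_of_point {X : Scheme.{u}} {I : X.IdealSheafData}
    (h : ∀ x : X, ∃ U : X.affineOpens, x ∈ U.1 ∧ (I.ideal U).FG) : FGS I := by
  choose U hx hU using h
  intro V
  refine of_affine_open_cover (P := fun V => (I.ideal V).FG) U ?_ V ?_ ?_ hU
  · rw [eq_top_iff]
    exact fun x _ => TopologicalSpace.Opens.mem_iSup.2 ⟨x, hx x⟩
  · intro U f hU
    exact fg_of_le (X.basicOpen_le f) hU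
  · intro U s hs H
    apply Ideal.fg_of_localizationSpan _ hs
    intro g
    have inst := U.2.isLocalization_basicOpen g.1
    have hg := H g
    rw [← I.map_ideal_basicOpen] at hg
    let e := IsLocalization.algEquiv (Submonoid.powers g.1) Γ(X, X.basicOpen g.1) (Localization.Away g.1)
    have he : (e : Γ(X, X.basicOpen g.1) →+* Localization.Away g.1).comp (algebraMap Γ(X, U.1) Γ(X, X.basicOpen g.1)) = algebraMap _ (Localization.Away g.1) :=
      RingHom.ext fun x => e.commutes x
    rw [← he, ← Ideal.map_map]
    exact hg.map _

lemma FGS.comap {X P : Scheme.{u}} (f : P ⟶ X) {I : X.IdealSheafData} (h : FGS I) :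
    FGS (I.comap f) := by
  refine fgs_of_point fun x => ?_
  obtain ⟨U, hxU, -⟩ := exists_affine_le (f x) ⊤ trivial
  obtain ⟨Q, hxQ, hQ⟩ := exists_affine_le x (f ⁻¹ᵁ U.1) hxU
  refine ⟨Q, hxQ, ?_⟩
  rw [ideal_comap f _ U Q hQ]
  exact (h U).map _

lemma FGS.sup {X : Scheme.{u}} {I J : X.IdealSheafData} (h : FGS I) (h' : FGS J) : FGS (I ⊔ J) := by
  intro U
  rw [IdealSheafData.ideal_sup]
  exact Submodule.FG.sup (h U) (h' U)

lemma FGS.bot {X : Scheme.{u}} : FGS (⊥ : X.IdealSheafData) := by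
  intro U
  rw [IdealSheafData.ideal_bot]
  exact Submodule.fg_bot

lemma ideal_le_of_comap_ι {X : Scheme.{u}} {I J : X.IdealSheafData} (O : X.Opens)
    (h : I.comap O.ι ≤ J.comap O.ι) (Q : X.affineOpens) (hQ : Q.1 ≤ O) :
    I.ideal Q ≤ J.ideal Q := by
  have hQ' : IsAffineOpen (O.ι ⁻¹ᵁ Q.1) := Q.2.preimage_of_isOpenImmersion _ (by simpa using hQ)
  have := h ⟨_, hQ'⟩
  rw [ideal_comap O.ι _ Q ⟨_, hQ'⟩ le_rfl, ideal_comap O.ι _ Q ⟨_, hQ'⟩ le_rfl] at this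
  have hb : Function.Bijective (O.ι.appLE Q.1 (O.ι ⁻¹ᵁ Q.1) le_rfl).hom := by
    rw [← Scheme.Hom.app_eq_appLE]
    have : IsIso (O.ι.app Q.1) := O.ι.isIso_app _ (by simpa using hQ)
    exact ConcreteCategory.bijective_of_isIso (O.ι.app Q.1)
  have h2 := Ideal.comap_mono (f := (O.ι.appLE Q.1 (O.ι ⁻¹ᵁ Q.1) le_rfl).hom) this
  rwa [Ideal.comap_map_of_bijective _ hb, Ideal.comap_map_of_bijective _ hb] at h2

lemma fg_map_exists {A C : Type u} [CommRing A] [CommRing C] (f : A →+* C) (I : Ideal A)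
    (h : (I.map f).FG) : ∃ I' : Ideal A, I'.FG ∧ I' ≤ I ∧ I.map f ≤ I'.map f := by
  obtain ⟨s', hs', e⟩ := (Submodule.fg_span_iff_fg_span_finset_subset _).1 h
  classical
  obtain ⟨t, ht, rfl⟩ := Finset.subset_set_image_iff.1 hs'
  refine ⟨Ideal.span t, ⟨t, rfl⟩, Ideal.span_le.2 ht, ?_⟩
  rw [Ideal.map_span]
  refine e.le.trans ?_
  rw [Finset.coe_image]

lemma map_res_appLE {X P : Scheme.{u}} (f : P ⟶ X) {U V : X.Opens} {Q : P.Opens} (h : V ≤ U)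
    (hQ : Q ≤ f ⁻¹ᵁ V) (I : Ideal Γ(X, U)) :
    (I.map (X.presheaf.map (homOfLE h).op).hom).map (f.appLE V Q hQ).hom =
      I.map (f.appLE U Q (hQ.trans (f.preimage_mono h))).hom := by
  rw [Ideal.map_map, ← CommRingCat.hom_comp, Scheme.Hom.map_appLE]

lemma ext_step {X : Scheme.{u}} [QuasiSeparatedSpace X] (J : X.IdealSheafData) (O : X.Opens)
    (hO : IsCompact (O : Set X)) (hJ : ∀ x ∈ O, ∃ Q : X.affineOpens, x ∈ Q.1 ∧ (J.ideal Q).FG)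
    (W : X.affineOpens) :
    ∃ J1 ≤ J, (∀ Q : X.affineOpens, Q.1 ≤ O → J1.ideal Q = J.ideal Q) ∧
      (J1.ideal W).FG := by
  have hOW : IsCompact ((O ⊓ W.1 : X.Opens) : Set X) :=
    QuasiSeparatedSpace.inter_isCompact _ _ O.2 hO W.1.2 W.2.isCompact
  have H : ∀ x ∈ O ⊓ W.1, ∃ f : Γ(X, W.1), x ∈ X.basicOpen f ∧ X.basicOpen f ≤ O ∧
      (J.ideal (X.affineBasicOpen f)).FG := by
    intro x hx
    obtain ⟨Q, hxQ, hQ⟩ := hJ x hx.1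
    obtain ⟨f, hf, hxf⟩ := W.2.exists_basicOpen_le (V := O ⊓ Q.1) ⟨x, hx.1, hxQ⟩ hx.2
    exact ⟨f, hxf, hf.trans inf_le_left, fg_of_le (V := Q) (hf.trans inf_le_right) hQ⟩
  choose! f hxf hfO hf using H
  obtain ⟨t, ht, hcov⟩ := hOW.elim_nhds_subcover (fun x => (X.basicOpen (f x) : Set X))
    (fun x hx => (X.basicOpen (f x)).2.mem_nhds (hxf x hx))
  have H2 : ∀ x ∈ t, ∃ I' : Ideal Γ(X, W.1), I'.FG ∧ I' ≤ J.ideal W ∧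
      J.ideal (X.affineBasicOpen (f x)) ≤
        I'.map (X.presheaf.map (homOfLE (X.basicOpen_le (f x))).op).hom := by
    intro x hx
    have := hf x (ht x hx)
    rw [← J.map_ideal_basicOpen] at this ⊢
    exact fg_map_exists _ _ this
  choose! I' hfg hle hI' using H2
  let J' : Ideal Γ(X, W.1) := t.sup I'
  have hJ'fg : J'.FG := Submodule.fg_finset_sup t I' hfg
  have hJ'le : J' ≤ J.ideal W := Finset.sup_le hle
  refine ⟨J ⊓ ext W J', inf_le_left, ?_, ?_⟩
  · intro Q hQ
    rw [IdealSheafData.ideal_inf, Pi.inf_apply]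
    refine inf_eq_left.2 (ideal_le_of_comap_ι O (le_comap_ext _ _ _ _ ?_) Q hQ)
    intro x hx
    obtain ⟨y, hy, hxy⟩ : ∃ y ∈ t, O.ι x ∈ X.basicOpen (f y) := by
      simpa using hcov (show O.ι x ∈ O ⊓ W.1 from ⟨x.2, hx⟩)
    have hQ' : IsAffineOpen (O.ι ⁻¹ᵁ (X.affineBasicOpen (f y)).1) :=
      (X.affineBasicOpen (f y)).2.preimage_of_isOpenImmersion _ (by simpa using hfO y (ht y hy))
    refine ⟨⟨_, hQ'⟩, O.ι.preimage_mono (X.basicOpen_le _), hxy, ?_⟩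
    rw [ideal_comap O.ι _ (X.affineBasicOpen (f y)) ⟨_, hQ'⟩ le_rfl]
    refine (Ideal.map_mono (hI' y hy)).trans ?_
    refine (map_res_appLE O.ι (X.basicOpen_le (f y)) _ _).le.trans ?_
    exact Ideal.map_mono (Finset.le_sup hy)
  · rw [IdealSheafData.ideal_inf, Pi.inf_apply, ext_ideal, inf_eq_right.2 hJ'le]
    exact hJ'fg

lemma exists_finite_affine_cover {X : Scheme.{u}} [CompactSpace X] (S : Set X.affineOpens)
    (hS : ∀ x : X, ∃ U ∈ S, x ∈ U.1) : ∃ t : Finset X.affineOpens, (↑t ⊆ S) ∧ ∀ x : X, ∃ U ∈ t, x ∈ U.1 := by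
  choose U hUS hxU using hS
  obtain ⟨t, ht⟩ := isCompact_univ.elim_nhds_subcover (fun x : X => ((U x).1 : Set X))
    (fun x _ => (U x).1.2.mem_nhds (hxU x))
  classical
  refine ⟨t.image U, ?_, fun x => ?_⟩
  · intro y hy
    obtain ⟨x, -, rfl⟩ := Finset.mem_image.1 hy
    exact hUS x
  · obtain ⟨y, hy, hxy⟩ : ∃ y ∈ t, x ∈ (U y).1 := by simpa using ht.2 (Set.mem_univ x)
    exact ⟨U y, Finset.mem_image_of_mem _ hy, hxy⟩

/-- `Ext'`. -/
lemma exists_fgs {X : Scheme.{u}} [CompactSpace X] [QuasiSeparatedSpace X] (N : X.IdealSheafData)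
    (U : X.affineOpens) (K : Ideal Γ(X, U.1)) (hK : K.FG) (hKN : K ≤ N.ideal U) :
    ∃ E : X.IdealSheafData, FGS E ∧ E ≤ N ∧ K ≤ E.ideal U := by
  classical
  have key : ∀ t : Finset X.affineOpens, ∃ E : X.IdealSheafData, E ≤ N ∧ E.ideal U = K ∧
      ∀ W ∈ t, (E.ideal W).FG := by
    intro t
    induction t using Finset.induction_on with
    | empty =>
      refine ⟨N ⊓ ext U K, inf_le_left, ?_, by simp⟩
      rw [IdealSheafData.ideal_inf, Pi.inf_apply, ext_ideal, inf_eq_right.2 hKN]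
    | insert W t hW ih =>
      obtain ⟨E, hEN, hEU, hE⟩ := ih
      let O : X.Opens := U.1 ⊔ t.sup (fun W => W.1)
      have hO : IsCompact (O : Set X) := by
        have e : (O : Set X) = (U.1 : Set X) ∪ ⋃ W ∈ t, (W.1 : Set X) := by
          simp [O, Finset.sup_eq_iSup]
        rw [e]
        exact U.2.isCompact.union (t.isCompact_biUnion fun W _ => W.2.isCompact)
      obtain ⟨E1, h1, h2, h3⟩ := ext_step E O hO (by
        intro x hx
        rcases hx with hx | hx
        · exact ⟨U, hx, hEU ▸ hK⟩
        · obtain ⟨W, hW, hx⟩ : ∃ W ∈ t, x ∈ W.1 := by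
            simpa [Finset.sup_eq_iSup] using hx
          exact ⟨W, hx, hE W hW⟩) W
      refine ⟨E1, h1.trans hEN, (h2 U le_sup_left).trans hEU, fun W' hW' => ?_⟩
      rcases Finset.mem_insert.1 hW' with rfl | hW'
      · exact h3
      · rw [h2 W' ((Finset.le_sup (f := fun W : X.affineOpens => W.1) hW').trans le_sup_right)]
        exact hE W' hW'
  obtain ⟨t, -, ht⟩ := exists_finite_affine_cover (X := X) Set.univ (fun x => by
    obtain ⟨U, h, -⟩ := exists_affine_le x ⊤ trivial
    exact ⟨U, trivial, h⟩)
  obtain ⟨E, hEN, hEU, hE⟩ := key t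
  refine ⟨E, fgs_of_point fun x => ?_, hEN, hEU.ge⟩
  obtain ⟨W, hW, hx⟩ := ht x
  exact ⟨W, hx, hE W hW⟩

variable {X P : Scheme.{u}} (D : Gpd X P)

lemma Lam_mono {J J' : X.IdealSheafData} (h : J ≤ J') : Lam D J ≤ Lam D J' :=
  (le_Lam D).2 (((le_Lam D).1 le_rfl).trans (IdealSheafData.comap_mono _ h))

lemma Lam_ext_mono {U : X.affineOpens} {K K' : Ideal Γ(X, U.1)} (h : K ≤ K') :
    Lam D (ext U K) ≤ Lam D (ext U K') := Lam_mono D (ext_mono h)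

lemma Lam_ext_ideal_le {U : X.affineOpens} (K : Ideal Γ(X, U.1)) :
    (Lam D (ext U K)).ideal U ≤ K := le_ext.1 (Lam_le D _)

def colon1 {A : Type u} [CommRing A] (M : Ideal A) (s : A) : Ideal A where
  carrier := {y | s * y ∈ M}
  add_mem' {a b} ha hb := by
    simp only [Set.mem_ofPred_eq, mul_add] at *
    exact M.add_mem ha hb
  zero_mem' := by simp
  smul_mem' c x hx := by
    simp only [Set.mem_ofPred_eq, smul_eq_mul] at *
    rw [mul_left_comm]
    exact M.mul_mem_left _ hx

/-- The statement `S_U(𝔞)`. -/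
def SS (U : X.affineOpens) {R : Type u} [CommRing R] (ρ : R →+* Γ(X, U.1)) (b : Ideal R) : Prop :=
  ∀ I : X.IdealSheafData, Inv D.p D.a I → ∀ E : X.IdealSheafData, FGS E → E ≤ I →
    ∃ E1 : X.IdealSheafData, FGS E1 ∧ E ≤ E1 ∧ E1 ≤ I ∧
      E1 ≤ Lam D (ext U (E1.ideal U ⊔ b.map ρ * I.ideal U))

/-- The statement of the prime lemma. -/
def PRS (U : X.affineOpens) {R : Type u} [CommRing R] (ρ : R →+* Γ(X, U.1)) : Prop :=
  ∀ b : Ideal R, b.IsPrime →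
  ∀ I : X.IdealSheafData, Inv D.p D.a I → ∀ E : X.IdealSheafData, FGS E → E ≤ I →
    ∃ E1 : X.IdealSheafData, FGS E1 ∧ E ≤ E1 ∧ E1 ≤ I ∧ ∃ s ∉ b,
      E1 ≤ Lam D (ext U (colon1 (E1.ideal U ⊔ b.map ρ * I.ideal U) (ρ s)))

lemma SS.mono {U : X.affineOpens} {R : Type u} [CommRing R] {ρ : R →+* Γ(X, U.1)} {b c : Ideal R}
    (h : SS D U ρ b) (hbc : b ≤ c) : SS D U ρ c := by
  intro I hI E hE hEI
  obtain ⟨E1, h1, h2, h3, h4⟩ := h I hI E hE hEI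
  exact ⟨E1, h1, h2, h3, h4.trans (Lam_ext_mono D
    (sup_le_sup_left (Ideal.mul_mono_left (Ideal.map_mono hbc)) _))⟩

lemma SS.top {U : X.affineOpens} {R : Type u} [CommRing R] {ρ : R →+* Γ(X, U.1)} :
    SS D U ρ ⊤ := by
  intro I hI E hE hEI
  refine ⟨E, hE, le_rfl, hEI, hEI.trans (((le_Lam D).2 hI).trans (Lam_mono D (le_ext.2 ?_)))⟩
  rw [Ideal.map_top, Ideal.top_mul]
  exact le_sup_right

lemma SS.mul {U : X.affineOpens} {R : Type u} [CommRing R] {ρ : R →+* Γ(X, U.1)} {b c : Ideal R}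
    (hb : SS D U ρ b) (hc : SS D U ρ c) : SS D U ρ (b * c) := by
  intro I hI E hE hEI
  have := D.flat
  obtain ⟨E1, h1, h2, h3, h4⟩ := hb I hI E hE hEI
  obtain ⟨E2, g1, g2, g3, g4⟩ := hc (I ⊓ Lam D (ext U (E1.ideal U ⊔ b.map ρ * I.ideal U)))
    (hI.inf (Lam_inv D _)) E1 h1 (le_inf h3 h4)
  refine ⟨E2, g1, h2.trans g2, g3.trans inf_le_left, g4.trans (Lam_ext_mono D ?_)⟩
  refine sup_le le_sup_left ?_
  rw [IdealSheafData.ideal_inf, Pi.inf_apply]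
  refine (Ideal.mul_mono_right (inf_le_right.trans (Lam_ext_ideal_le D _))).trans ?_
  rw [Ideal.mul_sup]
  refine sup_le (Ideal.mul_le_right.trans ((g2 U).trans le_sup_left)) ?_
  rw [← mul_assoc, ← Ideal.map_mul, mul_comm c b]
  exact le_sup_right

lemma SS.prime {U : X.affineOpens} {R : Type u} [CommRing R] {ρ : R →+* Γ(X, U.1)}
    (hPR : PRS D U ρ) {b : Ideal R} (hb : b.IsPrime) (H : ∀ c, b < c → SS D U ρ c) :
    SS D U ρ b := by
  intro I hI E hE hEI
  have := D.flat
  obtain ⟨E1, h1, h2, h3, s, hs, h4⟩ := hPR b hb I hI E hE hEI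
  have hlt : b < b ⊔ Ideal.span {s} := by
    refine lt_of_le_not_ge le_sup_left fun h => hs ?_
    exact h (Ideal.mem_sup_right (Ideal.mem_span_singleton_self s))
  obtain ⟨E2, g1, g2, g3, g4⟩ := H _ hlt _
    (hI.inf (Lam_inv D (ext U (colon1 (E1.ideal U ⊔ b.map ρ * I.ideal U) (ρ s)))))
    E1 h1 (le_inf h3 h4)
  refine ⟨E2, g1, h2.trans g2, g3.trans inf_le_left, g4.trans (Lam_ext_mono D ?_)⟩
  refine sup_le le_sup_left ?_
  rw [IdealSheafData.ideal_inf, Pi.inf_apply, Ideal.map_sup, Ideal.sup_mul]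
  refine sup_le ((Ideal.mul_mono_right inf_le_left).trans le_sup_right) ?_
  refine (Ideal.mul_mono_right (inf_le_right.trans (Lam_ext_ideal_le D _))).trans ?_
  rw [Ideal.map_span, Set.image_singleton, Ideal.span_singleton_mul_le_iff]
  intro z hz
  exact (sup_le_sup_right (g2 U) _) hz

lemma SS.all {U : X.affineOpens} {R : Type u} [CommRing R] [IsNoetherianRing R]
    {ρ : R →+* Γ(X, U.1)} (hPR : PRS D U ρ) (b : Ideal R) : SS D U ρ b := by
  refine IsNoetherian.induction (P := fun b : Ideal R => SS D U ρ b) ?_ b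
  intro (b : Ideal R) H
  by_cases hb : b.IsPrime
  · exact SS.prime D hPR hb H
  · rcases Ideal.not_isPrime_iff.1 hb with rfl | ⟨x, hx, y, hy, hxy⟩
    · exact SS.top D
    · have aux : ∀ s ∉ b, b < b ⊔ Ideal.span {s} := fun s hs =>
        lt_of_le_not_ge le_sup_left fun h => hs
          (h (Ideal.mem_sup_right (Ideal.mem_span_singleton_self s)))
      refine SS.mono D (SS.mul D (H _ (aux x hx)) (H _ (aux y hy))) ?_
      rw [Ideal.sup_mul, Ideal.mul_sup (Ideal.span _), Ideal.span_singleton_mul_span_singleton]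
      refine sup_le Ideal.mul_le_left (sup_le Ideal.mul_le_right ?_)
      rwa [Ideal.span_singleton_le_iff_mem]

def SB (U : X.affineOpens) : Prop :=
  ∀ I : X.IdealSheafData, Inv D.p D.a I → ∀ E : X.IdealSheafData, FGS E → E ≤ I →
    ∃ E1 : X.IdealSheafData, FGS E1 ∧ E ≤ E1 ∧ E1 ≤ I ∧ E1 ≤ Lam D (ext U (E1.ideal U))

lemma SB.of_PRS {U : X.affineOpens} {R : Type u} [CommRing R] [IsNoetherianRing R]
    {ρ : R →+* Γ(X, U.1)} (hPR : PRS D U ρ) : SB D U := by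
  have := SS.all D hPR ⊥
  simpa only [SB, SS, Ideal.map_bot, Ideal.bot_mul, sup_bot_eq] using this

lemma SB.finset (t : Finset X.affineOpens) (ht : ∀ U ∈ t, SB D U) :
    ∀ I : X.IdealSheafData, Inv D.p D.a I → ∀ E : X.IdealSheafData, FGS E → E ≤ I →
    ∃ E1 : X.IdealSheafData, FGS E1 ∧ E ≤ E1 ∧ E1 ≤ I ∧
      ∀ U ∈ t, E1 ≤ Lam D (ext U (E1.ideal U)) := by
  classical
  have := D.flat
  intro I hI E hE hEI
  induction t using Finset.induction_on with
  | empty => exact ⟨E, hE, le_rfl, hEI, by simp⟩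
  | insert W t hW ih =>
    obtain ⟨E1, h1, h2, h3, h4⟩ := ih fun U hU => ht U (Finset.mem_insert_of_mem hU)
    have aux : ∀ t' : Finset X.affineOpens, t' ⊆ t → ∃ I2, Inv D.p D.a I2 ∧ E1 ≤ I2 ∧ I2 ≤ I ∧
        ∀ U ∈ t', I2 ≤ Lam D (ext U (E1.ideal U)) := by
      intro t'
      induction t' using Finset.induction_on with
      | empty => exact fun _ => ⟨I, hI, h3, le_rfl, by simp⟩
      | insert U t' hU ih' =>
        intro h
        obtain ⟨I2, k1, k2, k3, k4⟩ := ih' ((Finset.subset_insert _ _).trans h)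
        refine ⟨I2 ⊓ Lam D (ext U (E1.ideal U)), k1.inf (Lam_inv D _),
          le_inf k2 (h4 U (h (Finset.mem_insert_self _ _))), inf_le_left.trans k3, ?_⟩
        intro U' hU'
        rcases Finset.mem_insert.1 hU' with rfl | hU'
        · exact inf_le_right
        · exact inf_le_left.trans (k4 U' hU')
    obtain ⟨I2, k1, k2, k3, k4⟩ := aux t subset_rfl
    obtain ⟨E2, g1, g2, g3, g4⟩ := ht W (Finset.mem_insert_self _ _) I2 k1 E1 h1 k2
    refine ⟨E2, g1, h2.trans g2, g3.trans k3, fun U hU => ?_⟩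
    rcases Finset.mem_insert.1 hU with rfl | hU
    · exact g4
    · exact g3.trans ((k4 U hU).trans (Lam_ext_mono D (g2 U)))

/-- `T`. -/
lemma exists_inv_fgs (h : ∀ x : X, ∃ U : X.affineOpens, x ∈ U.1 ∧ SB D U)
    (I : X.IdealSheafData) (hI : Inv D.p D.a I) (E : X.IdealSheafData) (hE : FGS E) (hEI : E ≤ I) :
    ∃ E1 : X.IdealSheafData, FGS E1 ∧ E ≤ E1 ∧ E1 ≤ I ∧ Inv D.p D.a E1 := by
  have := D.qcs
  have := D.qs
  obtain ⟨t, ht, hc⟩ := exists_finite_affine_cover {U | SB D U} (fun x => by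
    obtain ⟨U, h, h'⟩ := h x
    exact ⟨U, h', h⟩)
  obtain ⟨E1, h1, h2, h3, h4⟩ := SB.finset D t (fun U hU => ht hU) I hI E hE hEI
  refine ⟨E1, h1, h2, h3, le_of_point _ _ fun y => ?_⟩
  obtain ⟨U, hU, hyU⟩ := hc (D.p y)
  obtain ⟨Q, hyQ, hQ⟩ := exists_affine_le y (D.p ⁻¹ᵁ U.1) hyU
  refine ⟨Q, hyQ, ((le_Lam D).1 (h4 U hU) Q).trans ?_⟩
  rw [comap_ext_ideal _ _ _ _ hQ, ideal_comap _ _ U Q hQ]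

lemma exists_common {R : Type u} [CommRing R] (b : Ideal R) [b.IsPrime] {ι : Type*} [Finite ι]
    (Pr : ι → R → Prop) (hP : ∀ i s s', Pr i s → Pr i (s' * s)) (h : ∀ i, ∃ s ∉ b, Pr i s) :
    ∃ s ∉ b, ∀ i, Pr i s := by
  classical
  cases nonempty_fintype ι
  choose s hs hP' using h
  refine ⟨∏ i, s i, fun h => ?_, fun i => ?_⟩
  · obtain ⟨m, -, hm⟩ := (Ideal.IsPrime.prod_mem_iff).1 h
    exact hs m hm
  · rw [← Finset.prod_erase_mul _ _ (Finset.mem_univ i)]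
    exact hP _ _ _ (hP' i)

/-- Combined ring lemma. -/
lemma pr_comb {R C A E : Type u} [CommRing R] [CommRing C] [CommRing A] [CommRing E]
    (ρ : R →+* A) (σ : R →+* C) (q : A →+* E) (τ : C →+* E)
    (hpo : IsPushout (CommRingCat.ofHom ρ) (CommRingCat.ofHom σ) (CommRingCat.ofHom q)
      (CommRingCat.ofHom τ)) (b : Ideal R) [b.IsPrime] (I : Ideal A) (k : E) (hk : k ∈ I.map q) :
    ∃ NU : Ideal A, NU.FG ∧ NU ≤ I ∧ (∃ s ∉ b, q (ρ s) * k ∈ (NU ⊔ b.map ρ * I).map q) ∧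
      ∀ (A' E' : Type u) [CommRing A'] [CommRing E'] (α : A →+* A') (β : E →+* E') (q' : A' →+* E'),
        IsPushout (CommRingCat.ofHom (α.comp ρ)) (CommRingCat.ofHom σ) (CommRingCat.ofHom q')
          (CommRingCat.ofHom (β.comp τ)) → β.comp q = q'.comp α → q'.Flat →
        ∀ N' : Ideal A', (∀ r ∈ b, ∀ i ∈ I, α (ρ r) * α i ∈ N') → β k ∈ N'.map q' →
        ∃ t ∉ b, ∀ i ∈ NU, α (ρ t) * α i ∈ N' := by
  let := ρ.toAlgebra
  let := σ.toAlgebra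
  let := q.toAlgebra
  let := τ.toAlgebra
  let := (q.comp ρ).toAlgebra
  have : IsScalarTower R A E := .of_algebraMap_eq' rfl
  have : IsScalarTower R C E := .of_algebraMap_eq' (congrArg CommRingCat.Hom.hom hpo.w)
  have hbc : IsBaseChange A (IsScalarTower.toAlgHom R C E).toLinearMap :=
    (CommRingCat.isPushout_iff_isPushout.1 hpo).out
  obtain ⟨n, c, i, s, hs, hiI, hsum, hind⟩ := pr_ring_one _ hbc b I k hk
  refine ⟨Ideal.span (Set.range i), ⟨(Set.finite_range i).toFinset, by simp⟩,
    Ideal.span_le.2 (by rintro _ ⟨m, rfl⟩; exact hiI m), ⟨s, hs, ?_⟩, ?_⟩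
  · have h1 : ∑ m, τ (c m) * q (i m) ∈ (Ideal.span (Set.range i)).map q :=
      Ideal.sum_mem _ fun m _ => Ideal.mul_mem_left _ _
        (Ideal.mem_map_of_mem _ (Ideal.subset_span ⟨m, rfl⟩))
    have h2 := Ideal.add_mem ((Ideal.span (Set.range i) ⊔ b.map ρ * I).map q)
      (Ideal.map_mono le_sup_right hsum) (Ideal.map_mono le_sup_left h1)
    have h3 : q (ρ s) * k = algebraMap A E (algebraMap R A s) * k -
      ∑ m, (IsScalarTower.toAlgHom R C E).toLinearMap (c m) * algebraMap A E (i m) +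
        ∑ m, τ (c m) * q (i m) := (sub_add_cancel _ _).symm
    rw [h3]
    exact h2
  · intro A' E' _ _ α β q' hpo' hβ hflat N' hN hk'
    let := (α.comp ρ).toAlgebra
    let := q'.toAlgebra
    let := (β.comp τ).toAlgebra
    let := (q'.comp (α.comp ρ)).toAlgebra
    have : IsScalarTower R A' E' := .of_algebraMap_eq' rfl
    have : IsScalarTower R C E' := .of_algebraMap_eq' (congrArg CommRingCat.Hom.hom hpo'.w)
    have hbc' : IsBaseChange A' (IsScalarTower.toAlgHom R C E').toLinearMap :=
      (CommRingCat.isPushout_iff_isPushout.1 hpo').out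
    have hβ' : ∀ z, β (q z) = q' (α z) := fun z => RingHom.congr_fun hβ z
    have key : ∑ m, β (τ (c m)) * q' (α (i m)) ∈ N'.map q' := by
      have h1 : β (q (ρ s) * k) ∈ N'.map q' := by
        rw [map_mul]; exact Ideal.mul_mem_left _ _ hk'
      have h2 : β (q (ρ s) * k - ∑ m, τ (c m) * q (i m)) ∈ N'.map q' := by
        have h3 := Ideal.mem_map_of_mem β hsum
        refine (show Ideal.map β ((b.map ρ * I).map q) ≤ N'.map q' from ?_) h3
        rw [Ideal.map_map, hβ, ← Ideal.map_map]
        refine Ideal.map_mono ?_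
        rw [Ideal.map_mul, Ideal.map_map, Ideal.mul_le]
        intro x hx y hy
        refine Submodule.span_induction₂ (p := fun x y _ _ => x * y ∈ N') ?_ ?_ ?_ ?_ ?_ ?_ ?_ hx hy
        · rintro _ _ ⟨r, hr, rfl⟩ ⟨z, hz, rfl⟩
          exact hN r hr z hz
        · intro y _; simp
        · intro y _; simp
        · intro x y z _ _ _ h h'; rw [add_mul]; exact N'.add_mem h h'
        · intro x y z _ _ _ h h'; rw [mul_add]; exact N'.add_mem h h'
        · intro r x y _ _ h; rw [smul_eq_mul, mul_assoc]; exact N'.mul_mem_left _ h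
        · intro r x y _ _ h; rw [smul_eq_mul, mul_left_comm]; exact N'.mul_mem_left _ h
      have h4 := Ideal.sub_mem _ h1 h2
      rw [← map_sub, sub_sub_cancel, map_sum] at h4
      simpa only [map_mul, hβ'] using h4
    obtain ⟨t, ht, ht'⟩ := pr_ring_two _ hbc' hflat b c hind (fun m => α (i m)) N'
      (fun r hr m => hN r hr _ (hiI m)) key
    refine ⟨t, ht, fun z hz => ?_⟩
    have : Ideal.span (Set.range i) ≤ (colon1 N' (α (ρ t))).comap α := by
      rw [Ideal.span_le]
      rintro _ ⟨m, rfl⟩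
      exact ht' m
    exact this hz

lemma mem_ker_of_local {T X : Scheme.{u}} (f : T ⟶ X) [QuasiCompact f] (U : X.affineOpens)
    (n : Γ(X, U.1)) (h : ∀ t ∈ f ⁻¹ᵁ U.1, ∃ T' : T.Opens, ∃ hT : T' ≤ f ⁻¹ᵁ U.1, t ∈ T' ∧
      (f.appLE U.1 T' hT).hom n = 0) : n ∈ f.ker.ideal U := by
  rw [Hom.ker_apply, RingHom.mem_ker]
  refine TopCat.Presheaf.section_ext T.sheaf (f ⁻¹ᵁ U.1) _ _ fun t ht => ?_
  obtain ⟨T', hT, htT, h0⟩ := h t ht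
  rw [Hom.appLE, CommRingCat.hom_comp, RingHom.comp_apply] at h0
  have e := T.presheaf.germ_res_apply (homOfLE hT) t htT (f.app U.1 n)
  refine Eq.trans e.symm ?_
  refine (congrArg _ h0).trans ?_
  rw [map_zero]
  exact (map_zero (T.presheaf.germ _ t ht).hom).symm

variable {X P : Scheme.{u}} (D : Gpd X P)

lemma map_ext_eq_bot {T : Scheme.{u}} (U : X.affineOpens) (K : Ideal Γ(X, U.1)) (p : P ⟶ X)
    (g : T ⟶ P) (g' : T ⟶ Spec (.of (Γ(X, U.1) ⧸ K))) (hg : g ≫ p = g' ≫ zed U K)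
    (Q : P.Opens) (hQ : Q ≤ p ⁻¹ᵁ U.1) (T' : T.Opens) (hT : T' ≤ g ⁻¹ᵁ Q) :
    (K.map (p.appLE U.1 Q hQ).hom).map (g.appLE Q T' hT).hom = ⊥ := by
  have hz : (⊤ : (Spec (.of (Γ(X, U.1) ⧸ K))).Opens) ≤ zed U K ⁻¹ᵁ U.1 := (zed_preimage U K).ge
  rw [Ideal.map_map, ← CommRingCat.hom_comp, Scheme.Hom.appLE_comp_appLE]
  simp only [hg]
  rw [← Scheme.Hom.appLE_comp_appLE _ _ U.1 ⊤ T' hz le_top, CommRingCat.hom_comp, ← Ideal.map_map]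
  have : K.map ((zed U K).appLE U.1 ⊤ hz).hom = ⊥ := by
    rw [eq_bot_iff, Ideal.map_le_iff_le_comap, ← RingHom.ker_eq_comap_bot, ker_zed_appLE]
  rw [this, Ideal.map_bot]

lemma mem_Lam_ext (U : X.affineOpens) (K : Ideal Γ(X, U.1)) (n : Γ(X, U.1))
    (h : ∀ y : P, D.p y ∈ U.1 → D.a y ∈ U.1 → ∃ (Q : P.affineOpens) (hQp : Q.1 ≤ D.p ⁻¹ᵁ U.1)
      (hQa : Q.1 ≤ D.a ⁻¹ᵁ U.1), y ∈ Q.1 ∧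
      (D.a.appLE U.1 Q.1 hQa).hom n ∈ K.map (D.p.appLE U.1 Q.1 hQp).hom) :
    n ∈ (Lam D (ext U K)).ideal U := by
  have := D.flat
  have := D.qc_a
  have := D.qs
  have e : Lam D (ext U K) = (pullback.fst D.p (zed U K) ≫ D.a).ker := by
    rw [Hom.ker_comp, ← comap_ker_flat]; rfl
  rw [e]
  refine mem_ker_of_local _ _ _ fun t ht => ?_
  have hz : (⊤ : (Spec (.of (Γ(X, U.1) ⧸ K))).Opens) ≤ zed U K ⁻¹ᵁ U.1 := (zed_preimage U K).ge
  have hp : D.p (pullback.fst D.p (zed U K) t) ∈ U.1 := by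
    rw [← Scheme.Hom.comp_apply, pullback.condition, Scheme.Hom.comp_apply]
    exact hz trivial
  obtain ⟨Q, hQp, hQa, hyQ, hn⟩ := h (pullback.fst D.p (zed U K) t) hp (by
    rw [← Scheme.Hom.comp_apply]; exact ht)
  refine ⟨pullback.fst D.p (zed U K) ⁻¹ᵁ Q.1, ?_, hyQ, ?_⟩
  · rw [Scheme.Hom.comp_preimage]; exact Hom.preimage_mono _ hQa
  · rw [← Scheme.Hom.appLE_comp_appLE _ _ U.1 Q.1 _ hQa le_rfl, CommRingCat.hom_comp,
      RingHom.comp_apply]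
    have := Ideal.mem_map_of_mem ((pullback.fst D.p (zed U K)).appLE Q.1 _ le_rfl).hom hn
    rwa [map_ext_eq_bot U K D.p _ (pullback.snd _ _) pullback.condition] at this

/-- Local data at an affine open. -/
structure Loc (U : X.affineOpens) {R : Type u} [CommRing R] (ρ : R →+* Γ(X, U.1)) where
  J : Type
  fin : Finite J
  Q : J → P.affineOpens
  hQ : ∀ j, (Q j).1 ≤ D.p ⁻¹ᵁ U.1
  cov : ∀ y : P, D.p y ∈ U.1 → ∃ j, y ∈ (Q j).1
  C : J → CommRingCat.{u}
  σ : ∀ j, R →+* C j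
  τ : ∀ j, C j →+* Γ(P, (Q j).1)
  po : ∀ j, IsPushout (CommRingCat.ofHom ρ) (CommRingCat.ofHom (σ j)) (D.p.appLE U.1 (Q j).1 (hQ j))
    (CommRingCat.ofHom (τ j))
  inv : ∀ (V : P.Opens) (hp : V ≤ D.p ⁻¹ᵁ U.1) (ha : V ≤ D.a ⁻¹ᵁ U.1) (r : R),
    (D.p.appLE U.1 V hp).hom (ρ r) = (D.a.appLE U.1 V ha).hom (ρ r)

/-- saturation -/
def sat {A R : Type u} [CommRing A] [CommRing R] (ρ : R →+* A) (b : Ideal R) [hb : b.IsPrime]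
    (I M : Ideal A) : Ideal A where
  carrier := {y | y ∈ I ∧ ∃ s ∉ b, ρ s * y ∈ M}
  add_mem' {x y} hx hy := by
    obtain ⟨hx, s, hs, hsx⟩ := hx
    obtain ⟨hy, t, ht, hty⟩ := hy
    refine ⟨I.add_mem hx hy, s * t, fun h => ?_, ?_⟩
    · exact (hb.mem_or_mem h).elim hs ht
    · have : ρ (s * t) * (x + y) = ρ t * (ρ s * x) + ρ s * (ρ t * y) := by rw [map_mul]; ring
      rw [this]
      exact M.add_mem (M.mul_mem_left _ hsx) (M.mul_mem_left _ hty)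
  zero_mem' := ⟨I.zero_mem, 1, hb.one_notMem, by simp⟩
  smul_mem' c x hx := by
    obtain ⟨hx, s, hs, hsx⟩ := hx
    refine ⟨I.mul_mem_left _ hx, s, hs, ?_⟩
    rw [smul_eq_mul, mul_left_comm]
    exact M.mul_mem_left _ hsx

lemma colon1_mul {A : Type u} [CommRing A] (M : Ideal A) (s t : A) :
    colon1 M s ≤ colon1 M (t * s) := by
  intro x hx
  change t * s * x ∈ M
  rw [mul_assoc]
  exact M.mul_mem_left _ hx

lemma fg_le_sat {A R E : Type u} [CommRing A] [CommRing R] [CommRing E] (ρ : R →+* A) (b : Ideal R)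
    [b.IsPrime] (I M : Ideal A) (q : A →+* E) (F : Ideal E) (hF : F.FG)
    (hle : F ≤ (sat ρ b I M).map q) : ∃ s ∉ b, F ≤ (colon1 M (ρ s)).map q := by
  obtain ⟨t, rfl⟩ := hF
  have h : ∀ x : t, ∃ s ∉ b, x.1 ∈ (colon1 M (ρ s)).map q := by
    rintro ⟨x, hx⟩
    obtain ⟨n, c, i, hi, rfl⟩ := (mem_map_iff_sum _ _ _).1 (hle (Ideal.subset_span hx))
    obtain ⟨s, hs, hs'⟩ := exists_common b (fun m s => i m ∈ colon1 M (ρ s))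
      (fun i s s' h => by rw [map_mul]; exact colon1_mul _ _ _ h) (fun m => (hi m).2)
    refine ⟨s, hs, ?_⟩
    change ∑ m, c m * q (i m) ∈ _
    exact Ideal.sum_mem _ fun m _ => Ideal.mul_mem_left _ _ (Ideal.mem_map_of_mem q (hs' m))
  obtain ⟨s, hs, hs'⟩ := exists_common b (fun (x : t) s => x.1 ∈ (colon1 M (ρ s)).map q)
    (fun i s s' h => by rw [map_mul]; exact Ideal.map_mono (colon1_mul _ _ _) h) h
  exact ⟨s, hs, Ideal.span_le.2 fun x hx => hs' ⟨x, hx⟩⟩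

lemma isAffineOpen_pb {X Y S T : Scheme.{u}} {f : T ⟶ S} {g : Y ⟶ X} {iX : X ⟶ S} {iY : Y ⟶ T}
    (H : IsPullback g iY iX f) {US : S.Opens} {UT : T.Opens} {UX : X.Opens}
    (hUST : UT ≤ f ⁻¹ᵁ US) (hUSX : UX ≤ iX ⁻¹ᵁ US) {UY : Y.Opens}
    (hUY : UY = g ⁻¹ᵁ UX ⊓ iY ⁻¹ᵁ UT)
    (hUS : IsAffineOpen US) (hUT : IsAffineOpen UT) (hUX : IsAffineOpen UX) : IsAffineOpen UY := by
  have : IsAffine _ := hUS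
  have : IsAffine _ := hUT
  have : IsAffine _ := hUX
  exact .of_isIso (Scheme.Hom.isPullback_resLE H hUST hUSX hUY).isoPullback.hom

lemma cond_aux {R A A' : Type u} [CommRing R] [CommRing A] [CommRing A'] (ρ : R →+* A)
    (π α : A →+* A') (b : Ideal R) (I K : Ideal A) (hρ : ∀ r, π (ρ r) = α (ρ r))
    (hαI : ∀ i ∈ I, α i ∈ I.map π) (hK : b.map ρ * I ≤ K) (r : R) (hr : r ∈ b) (i : A) (hi : i ∈ I) :
    α (ρ r) * α i ∈ K.map π := by
  rw [← hρ]
  have h1 := Ideal.mul_mem_mul (Ideal.mem_map_of_mem π (Ideal.mem_map_of_mem ρ hr)) (hαI i hi)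
  rw [← Ideal.map_mul] at h1
  exact Ideal.map_mono hK h1

lemma le_sat {A R : Type u} [CommRing A] [CommRing R] (ρ : R →+* A) (b : Ideal R) [hb : b.IsPrime]
    (I M : Ideal A) {N : Ideal A} (hI : N ≤ I) (hM : N ≤ M) : N ≤ sat ρ b I M :=
  fun z hz => ⟨hI hz, 1, hb.one_notMem, by rw [map_one, one_mul]; exact hM hz⟩

lemma sat_sat {A R : Type u} [CommRing A] [CommRing R] (ρ : R →+* A) (b : Ideal R) [hb : b.IsPrime]
    (I M : Ideal A) (t : R) (ht : t ∉ b) (y : A) (hy : y ∈ I) (h : ρ t * y ∈ sat ρ b I M) :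
    y ∈ sat ρ b I M := by
  obtain ⟨-, s, hs, hsy⟩ := h
  refine ⟨hy, s * t, fun h => (hb.mem_or_mem h).elim hs ht, ?_⟩
  rw [map_mul, mul_assoc]
  exact hsy

variable {X P : Scheme.{u}} (D : Gpd X P)

/-- The affine open of the double product. -/
def dbl (Q1 Q2 : P.Opens) : (pullback D.p D.a).Opens :=
  pullback.fst D.p D.a ⁻¹ᵁ Q1 ⊓ pullback.snd D.p D.a ⁻¹ᵁ Q2

/-- core: membership transported along `m`. -/
lemma core_mem (U : X.affineOpens) (K : Ideal Γ(X, U.1)) (E : X.IdealSheafData)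
    (hE : E ≤ Lam D (ext U K)) (Q1 Q2 : P.affineOpens) (h1 : Q1.1 ≤ D.p ⁻¹ᵁ U.1)
    (h2a : Q2.1 ≤ D.a ⁻¹ᵁ U.1) (h2p : Q2.1 ≤ D.p ⁻¹ᵁ U.1) (k : Γ(P, Q1.1))
    (hk : k ∈ (E.comap D.a).ideal Q1) :
    ((pullback.fst D.p D.a).appLE Q1.1 (dbl D Q1.1 Q2.1) inf_le_left).hom k ∈
      (K.map (D.p.appLE U.1 Q2.1 h2p).hom).map
        ((pullback.snd D.p D.a).appLE Q2.1 (dbl D Q1.1 Q2.1) inf_le_right).hom := by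
  have := D.qs
  have hW : IsAffineOpen (dbl D Q1.1 Q2.1) :=
    isAffineOpen_pb (IsPullback.of_hasPullback D.p D.a) h2a h1 rfl U.2 Q2.2 Q1.2
  have e1 := ideal_comap (pullback.fst D.p D.a) (E.comap D.a) Q1 ⟨_, hW⟩ inf_le_left
  have e2 := ideal_comap (pullback.snd D.p D.a) ((ext U K).comap D.p) Q2 ⟨_, hW⟩ inf_le_right
  rw [comap_ext_ideal D.p U K Q2 h2p] at e2
  have h := Ideal.mem_map_of_mem ((pullback.fst D.p D.a).appLE Q1.1 (dbl D Q1.1 Q2.1) inf_le_left).hom hk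
  rw [← e1] at h
  rw [← e2]
  rw [← IdealSheafData.comap_comp, ← D.m_a, IdealSheafData.comap_comp] at h
  have h' : _ ∈ (((ext U K).comap D.p).comap D.m).ideal _ :=
    IdealSheafData.comap_mono D.m ((le_Lam D).1 hE) _ h
  rw [← IdealSheafData.comap_comp, D.m_p, IdealSheafData.comap_comp] at h'
  exact h'

lemma PRS.of_loc (U : X.affineOpens) {R : Type u} [CommRing R] (ρ : R →+* Γ(X, U.1))
    (L : Loc D U ρ) : PRS D U ρ := by
  intro b hb I hI E hE hEI
  have := D.flat
  have := D.qs
  have := D.qcs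
  have := L.fin
  let q := fun j => (D.p.appLE U.1 (L.Q j).1 (L.hQ j)).hom
  have hqf : ∀ j, (q j).Flat := fun j => D.p.flat_appLE U.2 (L.Q j).2 (L.hQ j)
  have hFfg : ∀ j, ((E.comap D.a).ideal (L.Q j)).FG := fun j => (hE.comap D.a) (L.Q j)
  have hF : ∀ j, (E.comap D.a).ideal (L.Q j) ≤ (I.ideal U).map (q j) := by
    intro j
    rw [← ideal_comap D.p I U (L.Q j) (L.hQ j)]
    exact (IdealSheafData.comap_mono D.a hEI (L.Q j)).trans (hI (L.Q j))
  choose G hG using hFfg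
  have hGF : ∀ j, ∀ k ∈ G j, k ∈ (E.comap D.a).ideal (L.Q j) := fun j k hk => by
    rw [← hG j]; exact Ideal.subset_span hk
  have H := fun (jk : Σ j, G j) => pr_comb ρ (L.σ jk.1) (q jk.1) (L.τ jk.1) (L.po jk.1) b
    (I.ideal U) jk.2.1 (hF _ (hGF _ _ jk.2.2))
  choose N hNfg hNI hNs hN using H
  let NU : Ideal Γ(X, U.1) := ⨆ jk, N jk
  have hNUfg : NU.FG := Submodule.fg_iSup _ hNfg
  have hNUI : NU ≤ I.ideal U := iSup_le hNI
  let M := NU ⊔ b.map ρ * I.ideal U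
  let K := sat ρ b (I.ideal U) M
  have hE1 : E ≤ Lam D (ext U K) := by
    rw [le_Lam]
    refine le_comap_ext _ _ _ _ fun y hy => ?_
    obtain ⟨j, hj⟩ := L.cov y hy
    refine ⟨L.Q j, L.hQ j, hj, ?_⟩
    rw [← hG j]
    refine Ideal.span_le.2 fun k hk => ?_
    obtain ⟨s, hs, hsk⟩ := hNs ⟨j, k, hk⟩
    refine flat_colon (q j) (hqf j) (I.ideal U) M K (ρ s) (fun y hy h => ⟨hy, s, hs, h⟩) k
      (hF j (hGF j k hk)) ?_
    exact Ideal.map_mono (sup_le_sup_right (le_iSup N ⟨j, k, hk⟩) _) hsk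
  have hbK : b.map ρ * I.ideal U ≤ K := le_sat ρ b _ _ Ideal.mul_le_right le_sup_right
  have hNL : ∀ jk, N jk ≤ (Lam D (ext U K)).ideal U := by
    intro jk n hn
    refine mem_Lam_ext D U K n fun y hyp hya => ?_
    obtain ⟨Q, hyQ, hQ⟩ := exists_affine_le y (D.p ⁻¹ᵁ U.1 ⊓ D.a ⁻¹ᵁ U.1) ⟨hyp, hya⟩
    have hQp := hQ.trans inf_le_left
    have hQa := hQ.trans inf_le_right
    refine ⟨Q, hQp, hQa, hyQ, ?_⟩
    let α := (D.a.appLE U.1 Q.1 hQa).hom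
    let π := (D.p.appLE U.1 Q.1 hQp).hom
    have hπ : π.Flat := D.p.flat_appLE U.2 Q.2 hQp
    have hαI : ∀ i ∈ I.ideal U, α i ∈ (I.ideal U).map π := by
      intro i hi
      rw [← ideal_comap D.p I U Q hQp]
      refine hI Q ?_
      rw [ideal_comap D.a I U Q hQa]
      exact Ideal.mem_map_of_mem _ hi
    have hρ : ∀ r, π (ρ r) = α (ρ r) := L.inv Q.1 hQp hQa
    have hpp := IsPullback.of_hasPullback D.p D.a
    have hW : IsAffineOpen (dbl D (L.Q jk.1).1 Q.1) :=
      isAffineOpen_pb hpp hQa (L.hQ jk.1) rfl U.2 Q.2 (L.Q jk.1).2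
    have hpo2 := (isIso_pushoutSection_iff hpp hQa (L.hQ jk.1)
      (UY := dbl D (L.Q jk.1).1 Q.1) rfl).1
      (isIso_pushoutSection_of_isAffineOpen hpp hQa (L.hQ jk.1) rfl U.2 Q.2 (L.Q jk.1).2)
    have hpo3 := (L.po jk.1).flip.paste_vert hpo2
    obtain ⟨t, ht, htn⟩ := hN jk Γ(P, Q.1) Γ(pullback D.p D.a, dbl D (L.Q jk.1).1 Q.1) α
      ((pullback.fst D.p D.a).appLE (L.Q jk.1).1 (dbl D (L.Q jk.1).1 Q.1) inf_le_left).hom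
      ((pullback.snd D.p D.a).appLE Q.1 (dbl D (L.Q jk.1).1 Q.1) inf_le_right).hom
      hpo3.flip (congrArg CommRingCat.Hom.hom hpo2.w)
      ((pullback.snd D.p D.a).flat_appLE Q.2 hW inf_le_right) (K.map π) (fun r hr i hi => cond_aux ρ π α b _ K hρ hαI hbK r hr i hi)
      (core_mem D U K E hE1 (L.Q jk.1) Q (L.hQ jk.1) hQa hQp jk.2.1 (hGF _ _ jk.2.2))
    have h2 := htn n hn
    rw [← hρ] at h2
    refine flat_colon π hπ (I.ideal U) K K (ρ t) ?_ (α n) (hαI n (hNI jk hn)) h2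
    exact fun y hy h => sat_sat ρ b _ _ t ht y hy h
  obtain ⟨E', hE'fg, hE'le, hE'U⟩ := exists_fgs (I ⊓ Lam D (ext U K)) U NU hNUfg (by
    rw [IdealSheafData.ideal_inf, Pi.inf_apply]
    exact le_inf hNUI (iSup_le hNL))
  have hE1le : E ⊔ E' ≤ I ⊓ Lam D (ext U K) := sup_le (le_inf hEI hE1) hE'le
  have hfg1 := hE.sup hE'fg
  refine ⟨E ⊔ E', hfg1, le_sup_left, hE1le.trans inf_le_left, ?_⟩
  let M1 := (E ⊔ E').ideal U ⊔ b.map ρ * I.ideal U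
  have hMM1 : M ≤ M1 := sup_le_sup_right (hE'U.trans ((le_sup_right : E' ≤ E ⊔ E') U)) _
  have hj : ∀ j, ∃ s ∉ b, ((E ⊔ E').comap D.a).ideal (L.Q j) ≤ (colon1 M1 (ρ s)).map (q j) := by
    intro j
    refine fg_le_sat ρ b (I.ideal U) M1 (q j) _ (hfg1.comap D.a (L.Q j)) ?_
    have h3 := (le_Lam D).1 (hE1le.trans inf_le_right) (L.Q j)
    rw [comap_ext_ideal D.p U K (L.Q j) (L.hQ j)] at h3
    refine h3.trans (Ideal.map_mono ?_)
    rintro y ⟨hy, s, hs, hsy⟩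
    exact ⟨hy, s, hs, hMM1 hsy⟩
  obtain ⟨s, hs, hs'⟩ := exists_common b
    (fun j s => ((E ⊔ E').comap D.a).ideal (L.Q j) ≤ (colon1 M1 (ρ s)).map (q j))
    (fun j s s' h => h.trans (by rw [map_mul]; exact Ideal.map_mono (colon1_mul _ _ _))) hj
  refine ⟨s, hs, ?_⟩
  rw [le_Lam]
  refine le_comap_ext _ _ _ _ fun y hy => ?_
  obtain ⟨j, hj⟩ := L.cov y hy
  exact ⟨L.Q j, L.hQ j, hj, hs' j⟩

lemma model_pushout {A C R : Type u} [CommRing A] [CommRing C] [CommRing R] [Algebra A C]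
    [Algebra R A] {n k : ℕ} (P : Algebra.Presentation A C (Fin n) (Fin k))
    (h : P.coeffs ⊆ Set.range (algebraMap R A)) :
    ∃ (C0 : CommRingCat.{u}) (σ : R →+* C0) (τ : C0 →+* C),
      IsPushout (CommRingCat.ofHom (algebraMap R A)) (CommRingCat.ofHom σ)
        (CommRingCat.ofHom (algebraMap A C)) (CommRingCat.ofHom τ) := by
  let : Algebra R C := ((algebraMap A C).comp (algebraMap R A)).toAlgebra
  have : IsScalarTower R A C := .of_algebraMap_eq fun _ => rfl
  have : P.HasCoeffs R := ⟨h⟩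
  let e := P.tensorModelOfHasCoeffsEquiv R
  refine ⟨.of (P.ModelOfHasCoeffs R), algebraMap _ _,
    (e : _ →+* C).comp (Algebra.TensorProduct.includeRight (R := R) (A := A)
      (B := P.ModelOfHasCoeffs R)).toRingHom, ?_⟩
  refine IsPushout.of_iso (CommRingCat.isPushout_tensorProduct R A (P.ModelOfHasCoeffs R))
    (.refl _) (.refl _) (.refl _) e.toRingEquiv.toCommRingCatIso ?_ ?_ ?_ ?_
  · simp
  · simp
  · ext a
    simpa [e] using e.commutes a
  · rfl

lemma noeth_descent {A : Type u} [CommRing A] (J : Type) [Finite J] (C : J → CommRingCat.{u})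
    (f : ∀ j, A →+* C j) (hf : ∀ j, (f j).FinitePresentation) :
    ∃ (R : CommRingCat.{u}) (_ : IsNoetherianRing R) (ρ : R →+* A) (C0 : J → CommRingCat.{u})
      (σ : ∀ j, R →+* C0 j) (τ : ∀ j, C0 j →+* C j), ∀ j,
      IsPushout (CommRingCat.ofHom ρ) (CommRingCat.ofHom (σ j))
        (CommRingCat.ofHom (f j)) (CommRingCat.ofHom (τ j)) := by
  let := fun j => (f j).toAlgebra
  have : ∀ j, Algebra.FinitePresentation A (C j) := hf
  let P := fun j => Algebra.Presentation.ofFinitePresentation A (C j)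
  let S : Set A := ⋃ j, (P j).coeffs
  have hS : S.Finite := Set.finite_iUnion fun j => (P j).finite_coeffs
  let R := Algebra.adjoin ℤ S
  have : Algebra.FiniteType ℤ R := .adjoin_of_finite hS
  have : IsNoetherianRing R := Algebra.FiniteType.isNoetherianRing ℤ R
  have key : ∀ j, (P j).coeffs ⊆ Set.range (algebraMap R A) := fun j a ha =>
    ⟨⟨a, Algebra.subset_adjoin (Set.mem_iUnion.2 ⟨j, ha⟩)⟩, rfl⟩
  choose C0 σ τ h using fun j => model_pushout (R := R) (P j) (key j)
  exact ⟨.of R, ‹_›, algebraMap R A, C0, σ, τ, h⟩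

variable {X P : Scheme.{u}} (D : Gpd X P)

lemma exists_SB {G B : Scheme.{u}} (π : G ⟶ B) (str : X ⟶ B) (g : P ⟶ G)
    (H : IsPullback D.p g str π) [LocallyOfFinitePresentation π] [QuasiCompact π]
    (ha : D.a ≫ str = D.p ≫ str) (x : X) : ∃ U : X.affineOpens, x ∈ U.1 ∧ SB D U := by
  obtain ⟨B0, hxB, -⟩ := exists_affine_le (str x) ⊤ trivial
  obtain ⟨U, hxU, hU⟩ := exists_affine_le x (str ⁻¹ᵁ B0.1) hxB
  refine ⟨U, hxU, ?_⟩
  obtain ⟨t, ht, et⟩ := isCompact_iff_finite_and_eq_biUnion_affineOpens.mp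
    (π.isCompact_preimage B0.2.isCompact)
  have := ht.to_subtype
  obtain ⟨n, ⟨eqv⟩⟩ := Finite.exists_equiv_fin t
  let W : Fin n → G.affineOpens := fun j => (eqv.symm j).1
  have hW : ∀ j, (W j).1 ≤ π ⁻¹ᵁ B0.1 := by
    intro j
    rw [et]
    exact le_iSup₂_of_le (W j) (eqv.symm j).2 le_rfl
  have hcov : ∀ y : G, π y ∈ B0.1 → ∃ j, y ∈ (W j).1 := by
    intro y hy
    have hy' : y ∈ π ⁻¹ᵁ B0.1 := hy
    rw [et] at hy'
    simp only [TopologicalSpace.Opens.mem_iSup] at hy'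
    obtain ⟨i, hi, hyi⟩ := hy'
    exact ⟨eqv ⟨i, hi⟩, by simpa [W] using hyi⟩
  obtain ⟨R, hR, ρ, C0, σ, τ, hpo⟩ := noeth_descent (Fin n) (fun j => Γ(G, (W j).1))
    (fun j => (π.appLE B0.1 (W j).1 (hW j)).hom)
    (fun j => π.finitePresentation_appLE B0.2 (W j).2 (hW j))
  have hQ : ∀ j, IsAffineOpen (D.p ⁻¹ᵁ U.1 ⊓ g ⁻¹ᵁ (W j).1) := fun j =>
    isAffineOpen_pb H (hW j) hU rfl B0.2 (W j).2 U.2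
  refine SB.of_PRS (R := R) D (ρ := (str.appLE B0.1 U.1 hU).hom.comp ρ) (PRS.of_loc D U _
    { J := Fin n, fin := inferInstance, Q := fun j => ⟨_, hQ j⟩, hQ := fun j => inf_le_left
      cov := ?_, C := C0, σ := σ
      τ := fun j => (g.appLE (W j).1 (D.p ⁻¹ᵁ U.1 ⊓ g ⁻¹ᵁ (W j).1) inf_le_right).hom.comp (τ j)
      po := ?_, inv := ?_ })
  · intro y hy
    obtain ⟨j, hj⟩ := hcov (g y) (by
      rw [← Scheme.Hom.comp_apply, ← H.w, Scheme.Hom.comp_apply]; exact hU hy)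
    exact ⟨j, hy, hj⟩
  · intro j
    have hpo2 := (isIso_pushoutSection_iff H (hW j) hU
      (UY := D.p ⁻¹ᵁ U.1 ⊓ g ⁻¹ᵁ (W j).1) rfl).1
      (isIso_pushoutSection_of_isAffineOpen H (hW j) hU rfl B0.2 (W j).2 U.2)
    exact (hpo j).paste_horiz hpo2
  · intro V hp ha' r
    have := Scheme.Hom.appLE_comp_appLE D.p str B0.1 U.1 V hU hp
    have h2 := Scheme.Hom.appLE_comp_appLE D.a str B0.1 U.1 V hU ha'
    have h3 : str.appLE B0.1 U.1 hU ≫ D.p.appLE U.1 V hp = str.appLE B0.1 U.1 hU ≫ D.a.appLE U.1 V ha' := by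
      rw [this, h2]; congr 1; exact ha.symm
    exact congrArg (fun φ => φ.hom (ρ r)) h3

lemma lfp_subschemeι {X : Scheme.{u}} (I : X.IdealSheafData) (h : FGS I) :
    LocallyOfFinitePresentation I.subschemeι := by
  refine (HasRingHomProperty.iff_exists_appLE (P := @LocallyOfFinitePresentation)
    (RingHom.finitePresentation_stableUnderComposition.stableUnderCompositionWithLocalizationAway
      RingHom.finitePresentation_holdsForLocalizationAway).left).2 fun z => ?_
  obtain ⟨U, hzU, -⟩ := exists_affine_le (I.subschemeι z) ⊤ trivial
  refine ⟨U, ⟨I.subschemeι ⁻¹ᵁ U.1, U.2.preimage _⟩, hzU, le_rfl, ?_⟩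
  rw [← Scheme.Hom.app_eq_appLE]
  refine RingHom.FinitePresentation.of_surjective _ (I.subschemeι_app_surjective U) ?_
  rw [I.ker_subschemeι_app]
  exact h U

lemma fgs_ker {X Y : Scheme.{u}} (c : X ⟶ Y) [IsClosedImmersion c] [LocallyOfFinitePresentation c] :
    FGS c.ker := by
  intro U
  rw [Hom.ker_apply]
  have h := c.finitePresentation_appLE U.2 (U.2.preimage c) le_rfl
  rw [← Scheme.Hom.app_eq_appLE] at h
  let := (c.app U.1).hom.toAlgebra
  have : Algebra.FinitePresentation Γ(Y, U.1) Γ(X, c ⁻¹ᵁ U.1) := h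
  exact Algebra.FinitePresentation.ker_fG_of_surjective (Algebra.ofId Γ(Y, U.1) Γ(X, c ⁻¹ᵁ U.1))
    (c.app_surjective U.1 U.2)

lemma isPullback_mono {V O X : Scheme.{u}} (c : V ⟶ O) (i : O ⟶ X) [Mono i] (ι : V ⟶ X)
    (h : c ≫ i = ι) : IsPullback c (𝟙 V) i ι :=
  IsPullback.of_isLimit' ⟨by simp [h]⟩ (PullbackCone.IsLimit.mk _ (fun s => s.snd)
    (fun s => by rw [← cancel_mono i, Category.assoc, h, s.condition]) (fun s => by simp)
    (fun s m h1 h2 => by simpa using h2))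

lemma ker_lift_open {V O X : Scheme.{u}} (c : V ⟶ O) (i : O ⟶ X) [IsOpenImmersion i] (ι : V ⟶ X)
    [QuasiCompact ι] (h : c ≫ i = ι) : c.ker = ι.ker.comap i := by
  rw [comap_ker_flat]
  have := (isPullback_mono c i ι h).isoPullback_hom_fst
  rw [← this, Hom.ker_comp_of_isIso]

lemma fg_of_comap_ι {X : Scheme.{u}} {I : X.IdealSheafData} (O : X.Opens)
    (h : FGS (I.comap O.ι)) (Q : X.affineOpens) (hQ : Q.1 ≤ O) : (I.ideal Q).FG := by
  have hQ' : IsAffineOpen (O.ι ⁻¹ᵁ Q.1) := Q.2.preimage_of_isOpenImmersion _ (by simpa using hQ)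
  have := h ⟨_, hQ'⟩
  rw [ideal_comap O.ι _ Q ⟨_, hQ'⟩ le_rfl] at this
  have hb : Function.Bijective (O.ι.appLE Q.1 (O.ι ⁻¹ᵁ Q.1) le_rfl).hom := by
    rw [← Scheme.Hom.app_eq_appLE]
    have : IsIso (O.ι.app Q.1) := O.ι.isIso_app _ (by simpa using hQ)
    exact ConcreteCategory.bijective_of_isIso (O.ι.app Q.1)
  obtain ⟨I', hI', hle, h2⟩ := fg_map_exists _ _ this
  have h3 := Ideal.comap_mono (f := (O.ι.appLE Q.1 (O.ι ⁻¹ᵁ Q.1) le_rfl).hom) h2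
  rw [Ideal.comap_map_of_bijective _ hb, Ideal.comap_map_of_bijective _ hb] at h3
  rwa [le_antisymm h3 hle]

lemma comap_ι_le {X : Scheme.{u}} {I J : X.IdealSheafData} (O : X.Opens)
    (h : ∀ y ∈ O, ∃ U : X.affineOpens, y ∈ U.1 ∧ I.ideal U ≤ J.ideal U) :
    I.comap O.ι ≤ J.comap O.ι := by
  refine le_of_point _ _ fun y => ?_
  obtain ⟨U, hyU, hU⟩ := h (O.ι y) y.2
  obtain ⟨Q, hyQ, hQ⟩ := exists_affine_le y (O.ι ⁻¹ᵁ U.1) hyU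
  refine ⟨Q, hyQ, ?_⟩
  rw [ideal_comap O.ι _ U Q hQ, ideal_comap O.ι _ U Q hQ]
  exact Ideal.map_mono hU

/-- Finite type approximation of the ideal near the subscheme. -/
lemma exists_start {X V : Scheme.{u}} [CompactSpace X] [QuasiSeparatedSpace X] (ι : V ⟶ X)
    [IsImmersion ι] [QuasiCompact ι] [LocallyOfFinitePresentation ι] :
    ∃ (O : X.Opens) (c : V ⟶ O) (E : X.IdealSheafData), IsClosedImmersion c ∧ c ≫ O.ι = ι ∧
      FGS E ∧ E ≤ ι.ker ∧ ∀ F, E ≤ F → F ≤ ι.ker → F.comap O.ι = ι.ker.comap O.ι := by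
  have hc0 := ι.liftCoborder_ι
  have : LocallyOfFinitePresentation ι.liftCoborder :=
    MorphismProperty.of_isPullback (P := @LocallyOfFinitePresentation)
      (isPullback_mono ι.liftCoborder ι.coborderRange.ι ι hc0).flip ‹_›
  have hfg : FGS (ι.ker.comap ι.coborderRange.ι) := by
    rw [← ker_lift_open ι.liftCoborder ι.coborderRange.ι ι hc0]
    exact fgs_ker _
  have : CompactSpace V := QuasiCompact.compactSpace_of_compactSpace ι
  have hW : ∀ v : V, ∃ W : X.affineOpens, ι v ∈ W.1 ∧ W.1 ≤ ι.coborderRange := fun v =>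
    exists_affine_le _ _ (subset_coborder ⟨v, rfl⟩)
  choose W hvW hWO using hW
  obtain ⟨t, ht⟩ := isCompact_univ.elim_finite_subcover (fun v => ((ι ⁻¹ᵁ (W v).1 : V.Opens) : Set V))
    (fun v => (ι ⁻¹ᵁ (W v).1).2) (fun v _ => Set.mem_iUnion.2 ⟨v, hvW v⟩)
  choose E hEfg hEI hE using fun v => exists_fgs ι.ker (W v) (ι.ker.ideal (W v))
    (fg_of_comap_ι _ hfg _ (hWO v)) le_rfl
  let O : X.Opens := ⨆ v ∈ t, (W v).1
  have hOle : O ≤ ι.coborderRange := iSup₂_le fun v _ => hWO v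
  have hr : Set.range ι ⊆ Set.range O.ι := by
    rintro _ ⟨v, rfl⟩
    obtain ⟨w, hw, hvw⟩ := Set.mem_iUnion₂.1 (ht (Set.mem_univ v))
    simp only [Opens.range_ι, O, SetLike.mem_coe, TopologicalSpace.Opens.mem_iSup]
    exact ⟨w, hw, hvw⟩
  let c : V ⟶ O := IsOpenImmersion.lift O.ι ι hr
  have hc : c ≫ O.ι = ι := IsOpenImmersion.lift_fac _ _ _
  have hc1 : c ≫ X.homOfLE hOle = ι.liftCoborder := by
    rw [← cancel_mono ι.coborderRange.ι, hc0, Category.assoc, Scheme.homOfLE_ι, hc]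
  have : IsClosedImmersion (c ≫ X.homOfLE hOle) := by rw [hc1]; infer_instance
  have : IsClosedImmersion c := IsClosedImmersion.of_comp c (X.homOfLE hOle)
  classical
  refine ⟨O, c, t.sup E, this, hc, ?_, Finset.sup_le fun v _ => hEI v, ?_⟩
  · exact Finset.sup_induction FGS.bot (fun _ h1 _ h2 => h1.sup h2) fun v _ => hEfg v
  · intro F hEF hFI
    refine le_antisymm (IdealSheafData.comap_mono _ hFI) (comap_ι_le _ fun y hy => ?_)
    simp only [O, TopologicalSpace.Opens.mem_iSup] at hy
    obtain ⟨v, hv, hy⟩ := hy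
    exact ⟨W v, hy, (hE v).trans (((Finset.le_sup hv).trans hEF) (W v))⟩

lemma exists_open_in {X V : Scheme.{u}} (ι : V ⟶ X) [QuasiCompact ι] (O : X.Opens) (c : V ⟶ O)
    [IsClosedImmersion c] (hc : c ≫ O.ι = ι) (F : X.IdealSheafData) (hF : F ≤ ι.ker)
    (h : F.comap O.ι = ι.ker.comap O.ι) :
    ∃ j : V ⟶ F.subscheme, IsOpenImmersion j ∧ j ≫ F.subschemeι = ι := by
  let j := IsClosedImmersion.lift F.subschemeι ι (by rwa [F.ker_subschemeι])
  have hj : j ≫ F.subschemeι = ι := IsClosedImmersion.lift_fac _ _ _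
  refine ⟨j, ?_, hj⟩
  let l : V ⟶ pullback O.ι F.subschemeι := pullback.lift c j (by rw [hc, hj])
  have hl : IsIso l := by
    refine IsClosedImmersion.isIso_of_ker_eq c (pullback.fst _ _) l (pullback.lift_fst _ _ _) ?_
    rw [ker_lift_open c O.ι ι hc, ← comap_ker_flat, F.ker_subschemeι, h]
  have : l ≫ pullback.snd _ _ = j := pullback.lift_snd _ _ _
  rw [← this]
  infer_instance

theorem main_two {X V P G B : Scheme.{u}} (D : Gpd X P) (π : G ⟶ B) (str : X ⟶ B) (g : P ⟶ G)
    (H : IsPullback D.p g str π) [LocallyOfFinitePresentation π] [QuasiCompact π]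
    (ha : D.a ≫ str = D.p ≫ str) (ι : V ⟶ X)
    [IsImmersion ι] [QuasiCompact ι] [LocallyOfFinitePresentation ι] (hI : Inv D.p D.a ι.ker) :
    ∃ (Z' : Scheme.{u}) (ι' : Z' ⟶ X), IsClosedImmersion ι' ∧
        LocallyOfFinitePresentation ι' ∧ Inv D.p D.a ι'.ker ∧
        ∃ j : V ⟶ Z', IsOpenImmersion j ∧ j ≫ ι' = ι := by
  have := D.qcs
  have := D.qs
  obtain ⟨O, c, E, hc, hcO, hE, hEI, hF⟩ := exists_start ι
  obtain ⟨E1, hE1, hEE1, hE1I, hinv⟩ := exists_inv_fgs D (exists_SB D π str g H ha) ι.ker hI E hE hEI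
  refine ⟨E1.subscheme, E1.subschemeι, inferInstance, lfp_subschemeι _ hE1, ?_,
    exists_open_in ι O c hcO E1 hE1I (hF E1 hEE1 hE1I)⟩
  rwa [E1.ker_subschemeι]

lemma mm_act_aux {C : Type*} [Category C] [HasBinaryProducts C] {T G X : C} (mul : G ⨯ G ⟶ G)
    (act : G ⨯ X ⟶ X) (h : prod.map mul (𝟙 X) ≫ act =
      (prod.associator G G X).hom ≫ prod.map (𝟙 G) act ≫ act) (y1 y2 : T ⟶ G ⨯ X)
    (h12 : y1 ≫ prod.snd = y2 ≫ act) :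
    prod.lift (prod.lift (y1 ≫ prod.fst) (y2 ≫ prod.fst) ≫ mul) (y2 ≫ prod.snd) ≫ act =
      y1 ≫ act := by
  have h1 : prod.lift (prod.lift (y1 ≫ prod.fst) (y2 ≫ prod.fst) ≫ mul) (y2 ≫ prod.snd) =
      prod.lift (prod.lift (y1 ≫ prod.fst) (y2 ≫ prod.fst)) (y2 ≫ prod.snd) ≫
      prod.map mul (𝟙 X) := by
    rw [prod.lift_map, Category.comp_id]
  have h2 : prod.lift (prod.lift (y1 ≫ prod.fst) (y2 ≫ prod.fst)) (y2 ≫ prod.snd) ≫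
      (prod.associator G G X).hom = prod.lift (y1 ≫ prod.fst) y2 := by
    apply prod.hom_ext
    · rw [prod.associator_hom, Category.assoc, prod.lift_fst, prod.lift_fst,
        prod.lift_fst_assoc, prod.lift_fst]
    · apply prod.hom_ext
      · rw [prod.associator_hom, Category.assoc, Category.assoc, prod.lift_snd_assoc,
          prod.lift_fst, prod.lift_fst_assoc, prod.lift_snd, prod.lift_snd]
      · rw [prod.associator_hom, Category.assoc, Category.assoc, prod.lift_snd_assoc,
          prod.lift_snd, prod.lift_snd, prod.lift_snd]
  rw [h1, Category.assoc, h, reassoc_of% h2, prod.lift_map_assoc, Category.comp_id, ← h12]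
  congr 1
  apply prod.hom_ext
  · rw [prod.lift_fst]
  · rw [prod.lift_snd]

section OverB
variable {B : Scheme.{u}} {G : GrpOver B} (x : GScheme B G)

/-- the action groupoid scheme -/
abbrev PP : Scheme.{u} := (G.carrier ⨯ x.carrier).left
/-- projection -/
def pp : PP x ⟶ x.sch := (prod.snd (X := G.carrier) (Y := x.carrier)).left
/-- action -/
def aa : PP x ⟶ x.sch := x.act.left
/-- projection to the group -/
def gg : PP x ⟶ G.sch := (prod.fst (X := G.carrier) (Y := x.carrier)).left

lemma pb_X : IsPullback (pp x) (gg x) x.str G.π :=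
  (Over.isPullback_of_binaryFan_isLimit _ (prodIsProd G.carrier x.carrier)).flip

lemma pp_str : pp x ≫ x.str = (G.carrier ⨯ x.carrier).hom := Over.w (prod.snd (X := G.carrier))
lemma aa_str : aa x ≫ x.str = (G.carrier ⨯ x.carrier).hom := Over.w x.act

/-- restricted product -/
abbrev SubP {W : Scheme.{u}} (ι : W ⟶ x.sch) : Scheme.{u} := (G.carrier ⨯ subOver x ι).left
/-- inclusion of the restricted product -/
def mp {W : Scheme.{u}} (ι : W ⟶ x.sch) : SubP x ι ⟶ PP x :=
  (prod.map (𝟙 G.carrier) (subHom x ι)).left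
/-- projection of the restricted product -/
def sn {W : Scheme.{u}} (ι : W ⟶ x.sch) : SubP x ι ⟶ W :=
  (prod.snd (X := G.carrier) (Y := subOver x ι)).left
/-- projection of the restricted product -/
def fs {W : Scheme.{u}} (ι : W ⟶ x.sch) : SubP x ι ⟶ G.sch :=
  (prod.fst (X := G.carrier) (Y := subOver x ι)).left

lemma mp_gg {W : Scheme.{u}} (ι : W ⟶ x.sch) : mp x ι ≫ gg x = fs x ι :=
  congrArg Over.Hom.left (show prod.map (𝟙 G.carrier) (subHom x ι) ≫ prod.fst = prod.fst by
    rw [prod.map_fst, Category.comp_id])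

lemma mp_pp {W : Scheme.{u}} (ι : W ⟶ x.sch) : mp x ι ≫ pp x = sn x ι ≫ ι :=
  congrArg Over.Hom.left (prod.map_snd (𝟙 G.carrier) (subHom x ι))

lemma pb_sub {W : Scheme.{u}} (ι : W ⟶ x.sch) : IsPullback (mp x ι) (sn x ι) (pp x) ι := by
  refine IsPullback.of_right (h₁₂ := gg x) (h₂₂ := x.str) (v₁₃ := G.π) ?_ (mp_pp x ι) (pb_X x).flip
  rw [mp_gg]
  exact Over.isPullback_of_binaryFan_isLimit (BinaryFan.mk prod.fst prod.snd) (prodIsProd G.carrier (subOver x ι))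

lemma inv_of_isInvariantSub [Flat (pp x)] {W : Scheme.{u}} (ι : W ⟶ x.sch) [QuasiCompact ι]
    (h : IsInvariantSub x ι) : Inv (pp x) (aa x) ι.ker := by
  obtain ⟨r, hr⟩ := h
  let r' : SubP x ι ⟶ W := r.left
  have hr' : r' ≫ ι = mp x ι ≫ aa x := congrArg Over.Hom.left hr
  refine inv_of_lift (pp x) (aa x) ι ((pb_sub x ι).isoPullback.inv ≫ r') ?_
  rw [← (pb_sub x ι).isoPullback_inv_fst, Category.assoc, Category.assoc, hr']

lemma isInvariantSub_of_inv [Flat (pp x)] {W : Scheme.{u}} (ι : W ⟶ x.sch) [IsClosedImmersion ι]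
    (h : Inv (pp x) (aa x) ι.ker) : IsInvariantSub x ι := by
  have hk : ι.ker ≤ (mp x ι ≫ aa x).ker := by
    rw [Hom.ker_comp]
    refine IdealSheafData.le_map_iff_comap_le.2 (h.trans ?_)
    rw [comap_ker_flat, ← (pb_sub x ι).isoPullback_hom_fst, Hom.ker_comp_of_isIso]
  have hl := IsClosedImmersion.lift_fac ι (mp x ι ≫ aa x) hk
  generalize IsClosedImmersion.lift ι (mp x ι ≫ aa x) hk = l at hl
  have hw : l ≫ ι ≫ x.str =
      (G.carrier ⨯ subOver x ι).hom := by
    rw [← Category.assoc, hl, Category.assoc, aa_str]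
    exact Over.w (prod.map (𝟙 G.carrier) (subHom x ι))
  refine ⟨Over.homMk (V := subOver x ι) l hw, ?_⟩
  exact Over.OverMorphism.ext hl

/-- the source of the composition -/
def TT : Over B := Over.mk (pullback.snd (pp x) (aa x) ≫ (G.carrier ⨯ x.carrier).hom)

lemma y1_w : pullback.fst (pp x) (aa x) ≫ (G.carrier ⨯ x.carrier).hom =
    pullback.snd (pp x) (aa x) ≫ (G.carrier ⨯ x.carrier).hom :=
  (congrArg (pullback.fst (pp x) (aa x) ≫ ·) (pp_str x).symm).trans
    ((pullback.condition_assoc x.str).trans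
      (congrArg (pullback.snd (pp x) (aa x) ≫ ·) (aa_str x)))

/-- first arrow -/
def y1 : TT x ⟶ G.carrier ⨯ x.carrier := Over.homMk (pullback.fst (pp x) (aa x)) (y1_w x)

/-- second arrow -/
def y2 : TT x ⟶ G.carrier ⨯ x.carrier := Over.homMk (pullback.snd (pp x) (aa x)) rfl

lemma y12 : y1 x ≫ prod.snd = y2 x ≫ x.act := by
  exact Over.OverMorphism.ext pullback.condition

/-- composition -/
def mm : TT x ⟶ G.carrier ⨯ x.carrier :=
  prod.lift (prod.lift (y1 x ≫ prod.fst) (y2 x ≫ prod.fst) ≫ G.mul) (y2 x ≫ prod.snd)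

lemma mm_act : mm x ≫ x.act = y1 x ≫ x.act :=
  mm_act_aux G.mul x.act x.mul_act (y1 x) (y2 x) (y12 x)

/-- The action groupoid. -/
def gpd (hf : Flat (pp x)) (hq : QuasiCompact (aa x)) (h1 : CompactSpace x.sch)
    (h2 : QuasiSeparatedSpace x.sch) : Gpd x.sch (PP x) where
  p := pp x
  a := aa x
  e := (prod.lift (terminal.from x.carrier ≫ G.one) (𝟙 x.carrier)).left
  m := (mm x).left
  e_p := by
    exact congrArg Over.Hom.left (prod.lift_snd (terminal.from x.carrier ≫ G.one) (𝟙 x.carrier))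
  e_a := by
    exact congrArg Over.Hom.left x.one_act
  m_p := by
    exact congrArg Over.Hom.left (show mm x ≫ prod.snd = y2 x ≫ prod.snd from prod.lift_snd _ _)
  m_a := by
    exact congrArg Over.Hom.left (mm_act x)
  flat := hf
  qc_a := hq
  qcs := h1
  qs := h2

end OverB

theorem final_thm
    {B : Scheme.{u}} {G : GrpOver B} (hG : G.FlatFinPres) (x : GScheme B G)
    {V : Scheme.{u}} (ι : V ⟶ x.sch) (hι : IsImmersion ι) (hqc : QuasiCompact ι)
    (hinv : IsInvariantSub x ι) :
    (∀ {Vbar : Scheme.{u}} (ιbar : Vbar ⟶ x.sch),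
      IsSchematicImage ι ιbar → IsInvariantSub x ιbar) ∧
    (QCQS x.sch → LocallyOfFinitePresentation ι →
      ∃ (Z' : Scheme.{u}) (ι' : Z' ⟶ x.sch), IsClosedImmersion ι' ∧
        LocallyOfFinitePresentation ι' ∧ IsInvariantSub x ι' ∧
        ∃ j : V ⟶ Z', IsOpenImmersion j ∧ j ≫ ι' = ι) := by
  obtain ⟨hflat, hlfp, hGqc, hGqs⟩ := hG
  have hπ : Flat G.π := Flat.of_stalkMap _ hflat
  have hp : Flat (pp x) := MorphismProperty.of_isPullback (P := @Flat) (pb_X x).flip hπ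
  have hpq : QuasiCompact (pp x) :=
    MorphismProperty.of_isPullback (P := @QuasiCompact) (pb_X x).flip hGqc
  have hI := inv_of_isInvariantSub x ι hinv
  constructor
  · intro Vbar ιbar h
    have := h.isClosedImmersion
    obtain ⟨g, hg⟩ := h.factors
    obtain ⟨h', hh'⟩ := h.isSmallest ι.imageι inferInstance ⟨ι.toImage, ι.toImage_imageι⟩
    have e1 : ιbar.ker ≤ ι.ker := by rw [← hg]; exact Hom.le_ker_comp _ _
    have e2 : ι.ker ≤ ιbar.ker := by
      have := Hom.le_ker_comp h' ι.imageι
      rw [hh'] at this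
      exact (IdealSheafData.ker_subschemeι _).ge.trans this
    refine isInvariantSub_of_inv x ιbar ?_
    rw [le_antisymm e1 e2]
    exact hI
  · rintro ⟨h1, h2⟩ hl
    have : CompactSpace (PP x) := QuasiCompact.compactSpace_of_compactSpace (pp x)
    have hq : QuasiCompact (aa x) := inferInstance
    obtain ⟨Z', ι', hc, hf, hI', hj⟩ := main_two (gpd x hp hq h1 h2) G.π x.str (gg x) (pb_X x)
      ((aa_str x).trans (pp_str x).symm) ι hI
    exact ⟨Z', ι', hc, hf, isInvariantSub_of_inv x ι' hI', hj⟩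

end Helpers

/-- Let `G` be a flat, finitely presented group scheme over `B`, let `X` be
a `G`-scheme, and let `V ⊆ X` be a `G`-invariant subscheme with quasi-compact immersion
`V ↪ X`.  Then the schematic closure of `V` in `X` is `G`-invariant.  If moreover `X` is
quasi-compact and quasi-separated and `V ↪ X` is of finite presentation, there is a finitely
presented `G`-invariant closed subscheme of `X` in which `V` is open. -/
theorem schematicClosure_invariant
    {B : Scheme.{u}} {G : GrpOver B} (hG : G.FlatFinPres) (x : GScheme B G)
    {V : Scheme.{u}} (ι : V ⟶ x.sch) (hι : IsImmersion ι) (hqc : QuasiCompact ι)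
    (hinv : IsInvariantSub x ι) :
    (∀ {Vbar : Scheme.{u}} (ιbar : Vbar ⟶ x.sch),
      IsSchematicImage ι ιbar → IsInvariantSub x ιbar) ∧
    (QCQS x.sch → LocallyOfFinitePresentation ι →
      ∃ (Z' : Scheme.{u}) (ι' : Z' ⟶ x.sch), IsClosedImmersion ι' ∧
        LocallyOfFinitePresentation ι' ∧ IsInvariantSub x ι' ∧
        ∃ j : V ⟶ Z', IsOpenImmersion j ∧ j ≫ ι' = ι) := by
  exact final_thm hG x ι hι hqc hinv

end EquivariantSix
end
end

section
/- Let d_0, d_1 : X_1 ⇉ X_0 be a groupoid scheme in which d_0 and d_1 are flat and of finite presentation, and let V ⊆ X_0 be an invariant subscheme such that the immersion V ↪ X_0 is quasi-compact. Then the schematic closure V̄ of V in X_0 is invariant: d_0^{-1}(V̄) = d_1^{-1}(V̄) as closed subschemes of X_1. -/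
open CategoryTheory CategoryTheory.Limits AlgebraicGeometry

noncomputable section

namespace EquivariantSix

universe u

/-- A groupoid scheme: schemes `X₁` (morphisms) and `X₀` (objects) with source and target
maps `d₀, d₁ : X₁ ⟶ X₀`, a unit `e`, a composition `comp` and an inversion `inv`, satisfying
the groupoid axioms (stated via generalized elements). -/
structure GroupoidScheme where
  X₀ : Scheme.{u}
  X₁ : Scheme.{u}
  d₀ : X₁ ⟶ X₀
  d₁ : X₁ ⟶ X₀
  e : X₀ ⟶ X₁
  e_d₀ : e ≫ d₀ = 𝟙 X₀
  e_d₁ : e ≫ d₁ = 𝟙 X₀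
  comp : pullback d₁ d₀ ⟶ X₁
  comp_d₀ : comp ≫ d₀ = pullback.fst d₁ d₀ ≫ d₀
  comp_d₁ : comp ≫ d₁ = pullback.snd d₁ d₀ ≫ d₁
  inv : X₁ ⟶ X₁
  inv_d₀ : inv ≫ d₀ = d₁
  inv_d₁ : inv ≫ d₁ = d₀
  comp_assoc : ∀ {T : Scheme.{u}} (f g h : T ⟶ X₁)
    (w₁ : f ≫ d₁ = g ≫ d₀) (w₂ : g ≫ d₁ = h ≫ d₀)
    (w₁₂ : (pullback.lift f g w₁ ≫ comp) ≫ d₁ = h ≫ d₀)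
    (w₂₃ : f ≫ d₁ = (pullback.lift g h w₂ ≫ comp) ≫ d₀),
    pullback.lift (pullback.lift f g w₁ ≫ comp) h w₁₂ ≫ comp =
      pullback.lift f (pullback.lift g h w₂ ≫ comp) w₂₃ ≫ comp
  id_comp : ∀ {T : Scheme.{u}} (f : T ⟶ X₁) (w : (f ≫ d₀ ≫ e) ≫ d₁ = f ≫ d₀),
    pullback.lift (f ≫ d₀ ≫ e) f w ≫ comp = f
  comp_id : ∀ {T : Scheme.{u}} (f : T ⟶ X₁) (w : f ≫ d₁ = (f ≫ d₁ ≫ e) ≫ d₀),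
    pullback.lift f (f ≫ d₁ ≫ e) w ≫ comp = f
  inv_comp : ∀ {T : Scheme.{u}} (f : T ⟶ X₁) (w : (f ≫ inv) ≫ d₁ = f ≫ d₀),
    pullback.lift (f ≫ inv) f w ≫ comp = f ≫ d₁ ≫ e
  comp_inv : ∀ {T : Scheme.{u}} (f : T ⟶ X₁) (w : f ≫ d₁ = (f ≫ inv) ≫ d₀),
    pullback.lift f (f ≫ inv) w ≫ comp = f ≫ d₀ ≫ e

/-- A subscheme `ι : Y ⟶ X₀` is invariant for the groupoid if `d₀⁻¹(Y) = d₁⁻¹(Y)` as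
subschemes of `X₁` (i.e. the two pullbacks are isomorphic over `X₁`). -/
def GroupoidScheme.IsInvariantSub (S : GroupoidScheme.{u}) {Y : Scheme.{u}}
    (ι : Y ⟶ S.X₀) : Prop :=
  ∃ φ : pullback S.d₀ ι ≅ pullback S.d₁ ι,
    φ.hom ≫ pullback.fst S.d₁ ι = pullback.fst S.d₀ ι

end EquivariantSix

namespace EquivariantSix

universe u

theorem ker_fst_schematicImage {T X Z Y : Scheme.{u}} (f : T ⟶ X) (i : Z ⟶ X) (d : Y ⟶ X)
    (hd : FlatHom d) [QuasiCompact f] (h : IsSchematicImage f i) :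
    (pullback.fst d i).ker = (pullback.fst d f).ker := by
  have := h.isClosedImmersion
  have : Flat d := Flat.of_stalkMap d hd
  obtain ⟨g, hg⟩ := h.factors
  have hqc : QuasiCompact g := by
    have : QuasiCompact (g ≫ i) := by rw [hg]; infer_instance
    exact QuasiCompact.of_comp g i
  have hdom : IsSchemeTheoreticallyDominant g := by
    obtain ⟨k, hk⟩ := h.isSmallest (g.imageι ≫ i) inferInstance ⟨g.toImage, by simp [hg]⟩
    have hk' : k ≫ g.imageι = 𝟙 Z := by
      rw [← cancel_mono i]; simpa using hk
    have h1 : g.imageι.ker ≤ (k ≫ g.imageι).ker := Scheme.Hom.le_ker_comp _ _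
    rw [hk'] at h1
    constructor
    rw [← le_bot_iff]
    simpa using h1
  subst hg
  let q : pullback d (g ≫ i) ⟶ pullback d i :=
    pullback.lift (pullback.fst _ _) (pullback.snd _ _ ≫ g) (by simp [pullback.condition])
  have hq1 : q ≫ pullback.fst d i = pullback.fst d (g ≫ i) := pullback.lift_fst _ _ _
  have hq2 : q ≫ pullback.snd d i = pullback.snd d (g ≫ i) ≫ g := pullback.lift_snd _ _ _
  have H : IsPullback q (pullback.snd d (g ≫ i)) (pullback.snd d i) g := by
    refine IsPullback.of_right ?_ hq2 (IsPullback.of_hasPullback d i)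
    rw [hq1]
    exact IsPullback.of_hasPullback d (g ≫ i)
  have hdq : IsSchemeTheoreticallyDominant q := .of_isPullback H.flip
  rw [← hq1, Scheme.Hom.ker_comp, q.ker_eq_bot, Scheme.IdealSheafData.map_bot]

/-- Let `d₀, d₁ : X₁ ⇉ X₀` be a groupoid scheme with `d₀` and `d₁` flat and
of finite presentation, and let `V ⊆ X₀` be an invariant subscheme whose immersion
`V ↪ X₀` is quasi-compact.  Then the schematic closure `V̄` of `V` in `X₀` is invariant:
`d₀⁻¹(V̄) = d₁⁻¹(V̄)` as closed subschemes of `X₁`. -/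
theorem schematicClosure_invariant_groupoid
    (S : GroupoidScheme.{u}) (hd₀ : FlatHom S.d₀ ∧ FinPresHom S.d₀)
    (hd₁ : FlatHom S.d₁ ∧ FinPresHom S.d₁)
    {V : Scheme.{u}} (ι : V ⟶ S.X₀) (hι : IsImmersion ι) (hqc : QuasiCompact ι)
    (hinv : S.IsInvariantSub ι)
    {Vbar : Scheme.{u}} (ιbar : Vbar ⟶ S.X₀) (hbar : IsSchematicImage ι ιbar) :
    S.IsInvariantSub ιbar := by
  have := hbar.isClosedImmersion
  obtain ⟨φ, hφ⟩ := hinv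
  have h : (pullback.fst S.d₁ ιbar).ker = (pullback.fst S.d₀ ιbar).ker := by
    rw [ker_fst_schematicImage ι ιbar S.d₀ hd₀.1 hbar,
      ker_fst_schematicImage ι ιbar S.d₁ hd₁.1 hbar, ← hφ, Scheme.Hom.ker_comp_of_isIso]
  have := IsClosedImmersion.isIso_of_ker_eq (pullback.fst S.d₀ ιbar) (pullback.fst S.d₁ ιbar)
    (IsClosedImmersion.lift _ _ h.le) (by simp) h.symm
  exact ⟨asIso (IsClosedImmersion.lift _ _ h.le), by simp⟩

end EquivariantSix
end
end
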